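/- Let D ⊂ ℝ² be a Jordan domain and let f : D → E ⊂ ℝ² be an orientation-preserving homeomorphism onto its image E = f(D) with no fixed points, such that D ∩ E is non-empty and connected. Then there exists a fixed-point-free orientation-preserving homeomorphism F : ℝ² → ℝ² extending f, i.e. with F|_D = f. -/

import Mathlib

open Set Filter Topology

noncomputable section

/-- The real plane. -/
abbrev Plane : Type := EuclideanSpace ℝ (Fin 2)

/-- `f` restricted to `X` is a homeomorphism onto its image `Y`
(for compact `X`, a continuous injection is a homeomorphism onto its image). -/
def IsHomeoOnto (f : Plane → Plane) (X Y : Set Plane) : Prop :=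
  ContinuousOn f X ∧ Set.InjOn f X ∧ f '' X = Y

/-- `f : X → f(X)` is isotopic to the identity on `X`: there is a continuous family
of homeomorphisms (continuous injections, `X` being compact in applications)
`h_t : X → h_t(X)`, `t ∈ [0,1]`, with `h_0 = id_X` and `h_1 = f`. -/
def IsotopicToIdOn (f : Plane → Plane) (X : Set Plane) : Prop :=
  ∃ H : ℝ → Plane → Plane,
    ContinuousOn (fun p : ℝ × Plane => H p.1 p.2) (Set.Icc (0:ℝ) 1 ×ˢ X) ∧
    (∀ x ∈ X, H 0 x = x) ∧
    (∀ x ∈ X, H 1 x = f x) ∧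
    (∀ t ∈ Set.Icc (0:ℝ) 1, Set.InjOn (H t) X)

/-- A Jordan domain: a subset of the plane homeomorphic to the closed unit disk. -/
def IsJordanDomain (D : Set Plane) : Prop :=
  Nonempty (↥D ≃ₜ ↥(Metric.closedBall (0:Plane) 1))

/-- A self-homeomorphism of the plane is orientation-preserving iff it is isotopic to
the identity through homeomorphisms of the plane (note that a continuous bijection of the
plane is automatically a homeomorphism, by invariance of domain). -/
def IsOrientationPreservingPlaneHomeo (F : Plane ≃ₜ Plane) : Prop :=
  ∃ H : ℝ → Plane → Plane,
    Continuous (fun p : ℝ × Plane => H p.1 p.2) ∧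
    (∀ x, H 0 x = x) ∧
    (∀ x, H 1 x = F x) ∧
    (∀ t ∈ Set.Icc (0:ℝ) 1, Function.Bijective (H t))

/-- A homeomorphism between planar sets (here: the restriction of `f` to `X`) is
orientation-preserving if it extends to an orientation-preserving homeomorphism of the plane. -/
def OrientationPreservingOn (f : Plane → Plane) (X : Set Plane) : Prop :=
  ∃ F : Plane ≃ₜ Plane, IsOrientationPreservingPlaneHomeo F ∧ Set.EqOn f (⇑F) X

/-- A Jordan curve: the image of a topological embedding of the circle
(a continuous injection of the compact circle, hence an embedding). -/
def IsJordanCurve (C : Set Plane) : Prop :=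
  ∃ γ : Plane → Plane, ContinuousOn γ (Metric.sphere (0:Plane) 1) ∧
    Set.InjOn γ (Metric.sphere (0:Plane) 1) ∧
    γ '' Metric.sphere (0:Plane) 1 = C

section

open Metric in
theorem norm_sub_sub_deriv_le {g : ℂ → ℂ} {c : ℂ} {r : ℝ} (hr : 0 < r)
    (hg : DifferentiableOn ℂ g (ball c r)) (hb : ∀ w ∈ ball c r, ‖g w‖ ≤ 1) {w : ℂ}
    (hw : w ∈ ball c r) :
    ‖g w - g c - deriv g c * (w - c)‖ ≤ 4 / r / r * ‖w - c‖ ^ 2 := by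
  have hc : c ∈ ball c r := mem_ball_self hr
  have hk : DifferentiableOn ℂ (dslope g c) (ball c r) :=
    (Complex.differentiableOn_dslope (isOpen_ball.mem_nhds hc)).2 hg
  have hmaps : MapsTo g (ball c r) (closedBall (g c) 2) := fun z hz => by
    rw [mem_closedBall, dist_eq_norm]
    linarith [norm_sub_le (g z) (g c), hb z hz, hb c hc]
  have hkb : ∀ z ∈ ball c r, ‖dslope g c z‖ ≤ 2 / r := fun z hz =>
    Complex.norm_dslope_le_div_of_mapsTo_ball hg hmaps hz
  have hkm : MapsTo (dslope g c) (ball c r) (closedBall (dslope g c c) (4 / r)) := fun z hz => by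
    rw [mem_closedBall, dist_eq_norm]
    have : 4 / r = 2 / r + 2 / r := by ring
    linarith [norm_sub_le (dslope g c z) (dslope g c c), hkb z hz, hkb c hc]
  have h1 := Complex.dist_le_div_mul_dist_of_mapsTo_ball hk hkm hw
  have h2 : g w - g c - deriv g c * (w - c) = (w - c) * (dslope g c w - dslope g c c) := by
    have := sub_smul_dslope g c w
    rw [smul_eq_mul] at this
    rw [dslope_same, mul_sub (w - c), this]; ring
  rw [h2, norm_mul, sq]
  rw [dist_eq_norm, dist_eq_norm] at h1
  nlinarith [norm_nonneg (w - c)]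

open Metric in
theorem norm_deriv_le_of_bounded {g : ℂ → ℂ} {c : ℂ} {r : ℝ} (hr : 0 < r)
    (hg : DifferentiableOn ℂ g (ball c r)) (hb : ∀ w ∈ ball c r, ‖g w‖ ≤ 1) :
    ‖deriv g c‖ ≤ 2 / r := by
  have hc : c ∈ ball c r := mem_ball_self hr
  refine Complex.norm_deriv_le_div_of_mapsTo_ball hg (fun z hz => ?_) hr
  rw [mem_closedBall, dist_eq_norm]
  linarith [norm_sub_le (g z) (g c), hb z hz, hb c hc]

open Metric in
/-- Pointwise ultrafilter limits of bounded holomorphic functions are holomorphic. -/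
theorem hasDerivAt_ultrafilter_limit {ι : Type*} (u : Ultrafilter ι) {g : ι → ℂ → ℂ} {G : ℂ → ℂ}
    {c : ℂ} {r : ℝ} (hr : 0 < r)
    (hg : ∀ n, DifferentiableOn ℂ (g n) (ball c r)) (hb : ∀ n, ∀ w ∈ ball c r, ‖g n w‖ ≤ 1)
    (hG : ∀ w ∈ ball c r, Tendsto (fun n => g n w) u (𝓝 (G w))) :
    ∃ d, HasDerivAt G d c ∧ Tendsto (fun n => deriv (g n) c) u (𝓝 d) := by
  have hc : c ∈ ball c r := mem_ball_self hr
  obtain ⟨d, -, hd⟩ := (isCompact_closedBall (0 : ℂ) (2 / r)).ultrafilter_le_nhds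
    (u.map fun n => deriv (g n) c) (by
      rw [le_principal_iff]
      refine Ultrafilter.mem_map.2 (Eventually.of_forall fun n => ?_)
      simpa using norm_deriv_le_of_bounded hr (hg n) (hb n))
  have hd' : Tendsto (fun n => deriv (g n) c) u (𝓝 d) := hd
  refine ⟨d, ?_, hd'⟩
  have key : ∀ w ∈ ball c r, ‖G w - G c - d * (w - c)‖ ≤ 4 / r / r * ‖w - c‖ ^ 2 := fun w hw => by
    refine le_of_tendsto (((hG w hw).sub (hG c hc)).sub (hd'.mul_const _)).norm
      (Eventually.of_forall fun n => norm_sub_sub_deriv_le hr (hg n) (hb n) hw)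
  rw [hasDerivAt_iff_isLittleO]
  have h1 : (fun w => G w - G c - (w - c) • d) =O[𝓝 c] fun w => ‖w - c‖ ^ 2 := by
    refine Asymptotics.IsBigO.of_bound (4 / r / r) ?_
    filter_upwards [isOpen_ball.mem_nhds hc] with w hw
    rw [smul_eq_mul, mul_comm, norm_pow, norm_norm]
    exact key w hw
  exact h1.trans_isLittleO (Asymptotics.isLittleO_pow_sub_sub c one_lt_two)

open Metric in
theorem eventually_norm_sub_lt_of_lipschitz {ι : Type*} {l : Filter ι} {g : ι → ℂ → ℂ}
    {G : ℂ → ℂ} {s : Set ℂ} (hs : IsCompact s) {L : ℝ}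
    (hL : ∀ n, ∀ w ∈ s, ∀ w' ∈ s, ‖g n w - g n w'‖ ≤ L * ‖w - w'‖)
    (hL' : ∀ w ∈ s, ∀ w' ∈ s, ‖G w - G w'‖ ≤ L * ‖w - w'‖)
    (hG : ∀ w ∈ s, Tendsto (fun n => g n w) l (𝓝 (G w))) {ε : ℝ} (hε : 0 < ε) :
    ∀ᶠ n in l, ∀ w ∈ s, ‖g n w - G w‖ < ε := by
  have hL0 : 0 < |L| + 1 := by positivity
  have hδ : 0 < ε / 3 / (|L| + 1) := by positivity
  obtain ⟨t, hts, htf, hcov⟩ := hs.finite_cover_balls hδ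
  have h1 : ∀ᶠ n in l, ∀ w ∈ t, ‖g n w - G w‖ < ε / 3 := by
    rw [eventually_all_finite htf]
    intro w hw
    have := hG w (hts hw)
    rw [Metric.tendsto_nhds] at this
    simpa [dist_eq_norm] using this (ε / 3) (by positivity)
  filter_upwards [h1] with n hn w hw
  obtain ⟨w', hw', hd⟩ := mem_iUnion₂.1 (hcov hw)
  have hd' : ‖w - w'‖ < ε / 3 / (|L| + 1) := by simpa [dist_eq_norm] using hd
  have hd2 : L * ‖w - w'‖ < ε / 3 := by
    rw [lt_div_iff₀ hL0] at hd'
    nlinarith [norm_nonneg (w - w'), le_abs_self L]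
  have e : g n w - G w = (g n w - g n w') + (g n w' - G w') - (G w - G w') := by ring
  rw [e]
  have := norm_sub_le ((g n w - g n w') + (g n w' - G w')) (G w - G w')
  have := norm_add_le (g n w - g n w') (g n w' - G w')
  linarith [hL n w hw w' (hts hw'), hL' w hw w' (hts hw'), hn w' hw']

open Metric in
/-- A Hurwitz-type theorem: a zero-free sequence of bounded holomorphic functions cannot
converge to a function with an isolated zero. -/
theorem eventually_eq_zero_of_ultrafilter_limit {ι : Type*} (u : Ultrafilter ι) {g : ι → ℂ → ℂ}
    {G : ℂ → ℂ} {c : ℂ} {r : ℝ} (hr : 0 < r)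
    (hg : ∀ n, DifferentiableOn ℂ (g n) (ball c r)) (hb : ∀ n, ∀ w ∈ ball c r, ‖g n w‖ ≤ 1)
    (hG : ∀ w ∈ ball c r, Tendsto (fun n => g n w) u (𝓝 (G w)))
    (hne : ∀ n, ∀ w ∈ ball c r, g n w ≠ 0) (h0 : G c = 0) : ∀ᶠ w in 𝓝 c, G w = 0 := by
  have hdiff : DifferentiableOn ℂ G (ball c r) := fun w hw => by
    obtain ⟨s, hs, hsub⟩ := Metric.isOpen_ball.mem_nhds hw |> Metric.mem_nhds_iff.1
    obtain ⟨d, hd, -⟩ := hasDerivAt_ultrafilter_limit u hs (fun n => (hg n).mono hsub)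
      (fun n z hz => hb n z (hsub hz)) (fun z hz => hG z (hsub hz))
    exact hd.differentiableAt.differentiableWithinAt
  have hGb : ∀ w ∈ ball c r, ‖G w‖ ≤ 1 := fun w hw =>
    le_of_tendsto (hG w hw).norm (Eventually.of_forall fun n => hb n w hw)
  have han : AnalyticAt ℂ G c := hdiff.analyticAt (isOpen_ball.mem_nhds (mem_ball_self hr))
  rcases han.eventually_eq_zero_or_eventually_ne_zero with h | h
  · exact h
  exfalso
  rw [eventually_nhdsWithin_iff] at h
  obtain ⟨s, hs, hsub⟩ := Metric.eventually_nhds_iff_ball.1 h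
  obtain ⟨t, ht0, hts, htr⟩ : ∃ t, 0 < t ∧ t < s ∧ t < r / 2 := by
    refine ⟨min s (r / 2) / 2, by positivity, ?_, ?_⟩
    · linarith [min_le_left s (r / 2), lt_min hs (by linarith : 0 < r / 2)]
    · linarith [min_le_right s (r / 2), lt_min hs (by linarith : 0 < r / 2)]
  have hsph : ∀ w ∈ sphere c t, G w ≠ 0 := fun w hw => by
    refine hsub w (by rw [mem_ball, mem_sphere.1 hw]; exact hts) ?_
    rintro rfl
    simp at hw
    exact ht0.ne hw
  have hcb : closedBall c t ⊆ ball c r := closedBall_subset_ball (by linarith)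
  have hlip : ∀ k : ℂ → ℂ, DifferentiableOn ℂ k (ball c r) → (∀ w ∈ ball c r, ‖k w‖ ≤ 1) →
      ∀ w ∈ sphere c t, ∀ w' ∈ sphere c t, ‖k w - k w'‖ ≤ 2 / (r / 2) * ‖w - w'‖ := by
    intro k hk hkb w hw w' hw'
    refine (convex_closedBall c t).norm_image_sub_le_of_norm_deriv_le (𝕜 := ℂ)
      (fun z hz => (hk z (hcb hz)).differentiableAt (isOpen_ball.mem_nhds (hcb hz))) (fun z hz => ?_)
      (sphere_subset_closedBall hw') (sphere_subset_closedBall hw)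
    have hsb : ball z (r / 2) ⊆ ball c r := ball_subset_ball' (by
      have := mem_closedBall.1 hz; linarith)
    exact norm_deriv_le_of_bounded (by linarith) (hk.mono hsb) (fun x hx => hkb x (hsb hx))
  have hcont : ContinuousOn G (sphere c t) :=
    hdiff.continuousOn.mono (sphere_subset_closedBall.trans hcb)
  obtain ⟨w0, hw0, hmin⟩ := (isCompact_sphere c t).exists_isMinOn
    ((NormedSpace.sphere_nonempty).2 ht0.le) hcont.norm
  set m := ‖G w0‖ with hm
  have hmpos : 0 < m := norm_pos_iff.2 (hsph w0 hw0)
  have hev := eventually_norm_sub_lt_of_lipschitz (isCompact_sphere c t)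
    (fun n => hlip (g n) (hg n) (hb n)) (hlip G hdiff hGb)
    (fun w hw => hG w (hcb (sphere_subset_closedBall hw))) (half_pos hmpos)
  have hev2 : ∀ᶠ n in u, ‖g n c‖ < m / 2 := by
    have := (hG c (mem_ball_self hr)).norm
    rw [h0, norm_zero] at this
    exact this.eventually (gt_mem_nhds (half_pos hmpos))
  obtain ⟨n, hn1, hn2⟩ := (hev.and hev2).exists
  have hinv : DiffContOnCl ℂ (fun w => (g n w)⁻¹) (ball c t) := by
    refine DifferentiableOn.diffContOnCl ?_
    rw [closure_ball c ht0.ne']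
    exact ((hg n).mono hcb).inv fun w hw => hne n w (hcb hw)
  have hle := Complex.norm_le_of_forall_mem_frontier_norm_le isBounded_ball hinv (C := 2 / m)
    (fun w hw => by
      rw [frontier_ball c ht0.ne'] at hw
      have h1 := hn1 w hw
      have h2 : m ≤ ‖G w‖ := hmin hw
      have h3 : m / 2 ≤ ‖g n w‖ := by
        have := norm_sub_norm_le (G w) (g n w)
        rw [norm_sub_rev] at this
        linarith
      rw [norm_inv, inv_le_comm₀ (by linarith) (by positivity), inv_div]
      exact h3) (subset_closure (mem_ball_self ht0))
  rw [norm_inv, inv_le_comm₀ (norm_pos_iff.2 (hne n c (mem_ball_self hr))) (by positivity),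
    inv_div] at hle
  linarith

open Metric in
/-- An injective holomorphic function has nonvanishing derivative. -/
theorem deriv_ne_zero_of_injOn_ball {f : ℂ → ℂ} {c : ℂ} {r : ℝ} (hr : 0 < r)
    (hf : DifferentiableOn ℂ f (ball c r)) (hi : InjOn f (ball c r)) : deriv f c ≠ 0 := by
  have hc := mem_ball_self (x := c) hr
  have han : AnalyticOnNhd ℂ f (ball c r) := hf.analyticOnNhd isOpen_ball
  have hopen : ∀ z ∈ ball c r, 𝓝 (f z) ≤ map f (𝓝 z) := fun z hz => by
    refine (han z hz).eventually_constant_or_nhds_le_map_nhds.resolve_left fun h => ?_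
    have h2 : ∀ᶠ w in 𝓝 z, w ∈ ball c r ∧ f w = f z := (isOpen_ball.mem_nhds hz |> eventually_mem_set.2).and h
    have h3 : ∀ᶠ w in 𝓝[≠] z, w = z :=
      (h2.mono fun w hw => hi hw.1 hz hw.2).filter_mono nhdsWithin_le_nhds
    obtain ⟨w, hw, hw'⟩ := (h3.and eventually_mem_nhdsWithin).exists
    exact hw' hw
  set g := Function.invFunOn f (ball c r) with hg
  have hgf : ∀ z ∈ ball c r, g (f z) = z := fun z hz => hi.leftInvOn_invFunOn hz
  have hgf' : ∀ z ∈ ball c r, ∀ᶠ w in 𝓝 (f z), f (g w) = w := fun z hz => by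
    refine hopen z hz ?_
    rw [mem_map]
    filter_upwards [isOpen_ball.mem_nhds hz] with w hw
    simp [hgf w hw]
  have hgc : ∀ z ∈ ball c r, ContinuousAt g (f z) := fun z hz => by
    rw [ContinuousAt, hgf z hz]
    refine (tendsto_map'_iff.2 ?_).mono_left (hopen z hz)
    refine tendsto_id.congr' ?_
    filter_upwards [isOpen_ball.mem_nhds hz] with w hw
    simp [hgf w hw]
  have hda : ∀ z ∈ ball c r, DifferentiableAt ℂ f z := fun z hz =>
    (hf z hz).differentiableAt (isOpen_ball.mem_nhds hz)
  have hdg : ∀ z ∈ ball c r, deriv f z ≠ 0 → DifferentiableAt ℂ g (f z) := fun z hz h => by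
    have h1 : HasDerivAt f (deriv f z) (g (f z)) := by rw [hgf z hz]; exact (hda z hz).hasDerivAt
    exact (HasDerivAt.of_local_left_inverse (hgc z hz) h1 h (hgf' z hz)).differentiableAt
  have hiso : ∀ᶠ z in 𝓝[≠] c, deriv f z ≠ 0 := by
    refine (han c hc).deriv.eventually_eq_zero_or_eventually_ne_zero.resolve_left fun h => ?_
    obtain ⟨s, hs, hsub⟩ := Metric.eventually_nhds_iff_ball.1 
      ((isOpen_ball.mem_nhds hc |> eventually_mem_set.2).and h)
    have hconst : ∀ w ∈ ball c s, f w = f c := fun w hw =>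
      IsOpen.is_const_of_deriv_eq_zero isOpen_ball (convex_ball c s).isPreconnected
        (hf.mono fun z hz => (hsub z hz).1) (fun z hz => (hsub z hz).2) hw (mem_ball_self hs)
    have h3 : ∀ᶠ w in 𝓝[≠] c, w = c := by
      refine Eventually.filter_mono nhdsWithin_le_nhds ?_
      filter_upwards [isOpen_ball.mem_nhds (mem_ball_self hs)] with w hw
      exact hi (hsub w hw).1 hc (hconst w hw)
    obtain ⟨w, hw, hw'⟩ := (h3.and eventually_mem_nhdsWithin).exists
    exact hw' hw
  have hgan : AnalyticAt ℂ g (f c) := by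
    refine Complex.analyticAt_of_differentiable_on_punctured_nhds_of_continuousAt ?_ (hgc c hc)
    rw [eventually_nhdsWithin_iff] at hiso ⊢
    refine hopen c hc ?_
    rw [mem_map]
    filter_upwards [isOpen_ball.mem_nhds hc, hiso] with z hz hz2 hz3
    exact hdg z hz (hz2 fun h => hz3 (by rw [mem_singleton_iff.1 h]; rfl))
  intro h0
  have h1 : HasDerivAt (g ∘ f) (deriv g (f c) * deriv f c) c :=
    hgan.differentiableAt.hasDerivAt.comp c (hda c hc).hasDerivAt
  have h2 : HasDerivAt (g ∘ f) 1 c := by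
    refine (hasDerivAt_id c).congr_of_eventuallyEq ?_
    filter_upwards [isOpen_ball.mem_nhds hc] with w hw
    exact hgf w hw
  have := h1.unique h2
  simp [h0] at this

end

section

/-- A topological space spread over the plane by `p`, with local sections `c x` of `p` on discs,
and neighbourhoods `U x` whose `p`-fibres are preconnected. -/
structure PlaneSpread (X : Type*) [TopologicalSpace X] where
  p : X → ℂ
  c : X → ℂ → X
  ε : X → ℝ
  U : X → Set X
  p_cont : Continuous p
  ε_pos : ∀ x, 0 < ε x
  U_nhds : ∀ x, U x ∈ 𝓝 x
  c_cont : ∀ x, ContinuousOn (c x) (Metric.ball (p x) (ε x))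
  c_self : ∀ x, c x (p x) = x
  c_mem : ∀ x, ∀ w ∈ Metric.ball (p x) (ε x), c x w ∈ U x
  p_c : ∀ x, ∀ w ∈ Metric.ball (p x) (ε x), p (c x w) = w
  p_U : ∀ x, ∀ y ∈ U x, p y ∈ Metric.ball (p x) (ε x)
  fiber : ∀ x w, IsPreconnected (U x ∩ p ⁻¹' {w})

namespace PlaneSpread

open Metric

variable {X : Type*} [TopologicalSpace X] (P : PlaneSpread X)

/-- Holomorphic functions on a spread. -/
def Hol (f : X → ℂ) : Prop :=
  ∀ x, DifferentiableOn ℂ (f ∘ P.c x) (ball (P.p x) (P.ε x)) ∧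
    ∀ y ∈ P.U x, f y = f (P.c x (P.p y))

/-- The derivative at `x` of a holomorphic function on a spread. -/
def der (f : X → ℂ) (x : X) : ℂ := deriv (f ∘ P.c x) (P.p x)

variable {P}

theorem mem_ball_p (x : X) : P.p x ∈ ball (P.p x) (P.ε x) := mem_ball_self (P.ε_pos x)

theorem ball_nhds (x : X) : ball (P.p x) (P.ε x) ∈ 𝓝 (P.p x) := ball_mem_nhds _ (P.ε_pos x)

theorem hol_p : P.Hol P.p := fun x =>
  ⟨differentiableOn_id.congr fun w hw => P.p_c x w hw,
    fun y hy => (P.p_c x _ (P.p_U x y hy)).symm⟩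

theorem Hol.continuous {f : X → ℂ} (hf : P.Hol f) : Continuous f := by
  rw [continuous_iff_continuousAt]
  intro x
  have h1 : ContinuousAt ((f ∘ P.c x) ∘ P.p) x :=
    ContinuousAt.comp (((hf x).1.continuousOn).continuousAt (ball_nhds x)) P.p_cont.continuousAt
  refine h1.congr ?_
  filter_upwards [P.U_nhds x] with y hy
  exact ((hf x).2 y hy).symm

theorem Hol.comp {f : X → ℂ} (hf : P.Hol f) {g : ℂ → ℂ} {s : Set ℂ} (hg : DifferentiableOn ℂ g s)
    (hfs : ∀ x, f x ∈ s) : P.Hol (fun x => g (f x)) := fun x =>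
  ⟨hg.comp (hf x).1 fun _ _ => hfs _, fun y hy => congrArg g ((hf x).2 y hy)⟩

theorem Hol.differentiableAt {f : X → ℂ} (hf : P.Hol f) (x : X) :
    DifferentiableAt ℂ (f ∘ P.c x) (P.p x) := (hf x).1.differentiableAt (ball_nhds x)

theorem Hol.hasDerivAt {f : X → ℂ} (hf : P.Hol f) (x : X) :
    HasDerivAt (f ∘ P.c x) (P.der f x) (P.p x) := (hf.differentiableAt x).hasDerivAt

/-- A continuous square root of a nonvanishing holomorphic function is holomorphic. -/
theorem Hol.of_sq {h : X → ℂ} (hc : Continuous h) (h0 : ∀ x, h x ≠ 0)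
    (hf : P.Hol (fun x => h x ^ 2)) : P.Hol h := by
  intro x
  refine ⟨fun w hw => ?_, fun y hy => ?_⟩
  · have hcont : ContinuousAt (h ∘ P.c x) w :=
      hc.continuousAt.comp ((P.c_cont x).continuousAt (isOpen_ball.mem_nhds hw))
    have hd : HasDerivAt ((fun x => h x ^ 2) ∘ P.c x) _ w :=
      ((hf x).1.differentiableAt (isOpen_ball.mem_nhds hw)).hasDerivAt
    have hsq : HasDerivAt (fun z : ℂ => z ^ 2) (2 * h (P.c x w)) (h (P.c x w)) := by
      simpa using hasDerivAt_pow 2 (h (P.c x w))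
    have hne : 2 * h (P.c x w) ≠ 0 := mul_ne_zero two_ne_zero (h0 _)
    have hstrict : HasStrictDerivAt (fun z : ℂ => z ^ 2) (2 * h (P.c x w)) (h (P.c x w)) := by
      simpa using hasStrictDerivAt_pow 2 (h (P.c x w))
    set k := hstrict.localInverse _ _ _ hne with hk
    have hleft : ∀ᶠ z in 𝓝 (h (P.c x w)), k (z ^ 2) = z := hstrict.eventually_left_inverse hne
    have hkd : HasDerivAt k (2 * h (P.c x w))⁻¹ (h (P.c x w) ^ 2) :=
      (hstrict.to_localInverse hne).hasDerivAt
    have h1 : DifferentiableAt ℂ (k ∘ ((fun x => h x ^ 2) ∘ P.c x)) w :=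
      DifferentiableAt.comp w hkd.differentiableAt hd.differentiableAt
    refine (h1.congr_of_eventuallyEq ?_).differentiableWithinAt
    filter_upwards [hcont.eventually hleft] with z hz
    exact hz.symm
  · have hy' := P.p_U x y hy
    have hm : P.c x (P.p y) ∈ P.U x ∩ P.p ⁻¹' {P.p y} := ⟨P.c_mem x _ hy', P.p_c x _ hy'⟩
    refine (P.fiber x (P.p y)).eq_of_sq_eq (f := h) (g := fun _ => h (P.c x (P.p y)))
      hc.continuousOn continuousOn_const (fun z hz => ?_) (fun _ => h0 _) hm rfl ⟨hy, rfl⟩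
    have h1 := (hf x).2 z hz.1
    have h2 : P.p z = P.p y := hz.2
    simp only [h2] at h1
    simpa using h1

/-- A holomorphic function on a connected spread with a nonzero derivative somewhere is nowhere
locally constant. -/
theorem Hol.not_eventually_const [PreconnectedSpace X] {f : X → ℂ} (hf : P.Hol f) {x₀ : X}
    (hd : P.der f x₀ ≠ 0) (x : X) {a : ℂ} : ¬ ∀ᶠ w in 𝓝 (P.p x), f (P.c x w) = a := by
  set A : Set X := {x | ∃ a, ∀ᶠ y in 𝓝 x, f y = a} with hA
  have hup : ∀ x (a : ℂ), (∀ᶠ w in 𝓝 (P.p x), f (P.c x w) = a) → ∀ᶠ y in 𝓝 x, f y = a := by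
    intro x a h
    filter_upwards [P.p_cont.continuousAt.eventually h, P.U_nhds x] with y hy hy2
    rw [(hf x).2 y hy2, hy]
  have hopen : IsOpen A := by
    rw [isOpen_iff_mem_nhds]
    rintro x ⟨a, ha⟩
    filter_upwards [eventually_eventually_nhds.2 ha] with y hy
    exact ⟨a, hy⟩
  have hclosed : IsClosed A := by
    rw [← closure_subset_iff_isClosed]
    intro x hx
    obtain ⟨y, hyU, a, hya⟩ := mem_closure_iff_nhds.1 hx (interior (P.U x))
      (interior_mem_nhds.2 (P.U_nhds x))
    have hyb := P.p_U x y (interior_subset hyU)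
    have hcy : ContinuousAt (P.c y) (P.p y) := (P.c_cont y).continuousAt (ball_nhds y)
    have h1 : ∀ᶠ w in 𝓝 (P.p y), f (P.c x w) = a := by
      have e1 : ∀ᶠ w in 𝓝 (P.p y), f (P.c y w) = a ∧ P.c y w ∈ P.U x := by
        refine hcy.eventually (p := fun z => f z = a ∧ z ∈ P.U x) ?_
        rw [P.c_self]
        exact hya.and (mem_interior_iff_mem_nhds.1 hyU)
      filter_upwards [e1, ball_nhds y] with w hw hw2
      rw [← hw.1, (hf x).2 _ hw.2, P.p_c y w hw2]
    have h2 : EqOn (f ∘ P.c x) (fun _ => a) (ball (P.p x) (P.ε x)) :=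
      ((hf x).1.analyticOnNhd isOpen_ball).eqOn_of_preconnected_of_eventuallyEq
        analyticOnNhd_const (convex_ball _ _).isPreconnected hyb h1
    refine ⟨a, hup x a ?_⟩
    filter_upwards [ball_nhds x] with w hw using h2 hw
  intro h
  have hAne : A.Nonempty := ⟨x, a, hup x a h⟩
  have hAu : A = univ := IsClopen.eq_univ ⟨hclosed, hopen⟩ hAne
  obtain ⟨b, hb⟩ : x₀ ∈ A := hAu ▸ mem_univ x₀
  apply hd
  have hc0 : ContinuousAt (P.c x₀) (P.p x₀) := (P.c_cont x₀).continuousAt (ball_nhds x₀)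
  have h3 : (f ∘ P.c x₀) =ᶠ[𝓝 (P.p x₀)] fun _ => b := by
    refine hc0.eventually (p := fun z => f z = b) ?_
    rwa [P.c_self]
  unfold der
  rw [h3.deriv_eq, deriv_const]

/-- Pointwise ultrafilter limits of uniformly bounded holomorphic functions on a spread. -/
theorem Hol.ultrafilter_limit {ι : Type*} (u : Ultrafilter ι) {g : ι → X → ℂ} {G : X → ℂ}
    (hg : ∀ n, P.Hol (g n)) (hb : ∀ n x, ‖g n x‖ ≤ 1)
    (hG : ∀ x, Tendsto (fun n => g n x) u (𝓝 (G x))) :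
    P.Hol G ∧ ∀ x, Tendsto (fun n => P.der (g n) x) u (𝓝 (P.der G x)) := by
  have key : ∀ x, ∀ w ∈ ball (P.p x) (P.ε x), ∃ d, HasDerivAt (G ∘ P.c x) d w ∧
      Tendsto (fun n => deriv (g n ∘ P.c x) w) u (𝓝 d) := fun x w hw => by
    obtain ⟨s, hs, hsub⟩ := Metric.mem_nhds_iff.1 (isOpen_ball.mem_nhds hw)
    exact hasDerivAt_ultrafilter_limit u hs (fun n => ((hg n) x).1.mono hsub)
      (fun n z hz => hb n _) (fun z hz => hG _)
  refine ⟨fun x => ⟨fun w hw => ?_, fun y hy => ?_⟩, fun x => ?_⟩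
  · obtain ⟨d, hd, -⟩ := key x w hw
    exact hd.differentiableAt.differentiableWithinAt
  · refine tendsto_nhds_unique (hG y) ((hG _).congr fun n => ?_)
    exact ((hg n x).2 y hy).symm
  · obtain ⟨d, hd, hd'⟩ := key x _ (mem_ball_p x)
    unfold der
    rw [hd.deriv]
    exact hd'

theorem norm_mobius_lt {a z : ℂ} (ha : ‖a‖ < 1) (hz : ‖z‖ < 1) :
    ‖(z - a) / (1 - starRingEnd ℂ a * z)‖ < 1 := by
  have hne : 1 - starRingEnd ℂ a * z ≠ 0 := fun h => by
    have : ‖starRingEnd ℂ a * z‖ = 1 := by rw [← sub_eq_zero.1 h, norm_one]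
    rw [norm_mul, RCLike.norm_conj] at this
    nlinarith [norm_nonneg a, norm_nonneg z]
  rw [norm_div, div_lt_one (norm_pos_iff.2 hne)]
  refine lt_of_pow_lt_pow_left₀ 2 (norm_nonneg _) ?_
  rw [← Complex.normSq_eq_norm_sq, ← Complex.normSq_eq_norm_sq]
  have e : Complex.normSq (1 - starRingEnd ℂ a * z) - Complex.normSq (z - a) =
      (1 - ‖a‖ ^ 2) * (1 - ‖z‖ ^ 2) := by
    rw [← Complex.normSq_eq_norm_sq, ← Complex.normSq_eq_norm_sq]
    simp only [Complex.normSq_apply, Complex.sub_re, Complex.sub_im, Complex.mul_re,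
      Complex.mul_im, Complex.conj_re, Complex.conj_im, Complex.one_re, Complex.one_im]
    ring
  have h1 : 0 < (1 - ‖a‖ ^ 2) * (1 - ‖z‖ ^ 2) :=
    mul_pos (by nlinarith [norm_nonneg a]) (by nlinarith [norm_nonneg z])
  linarith

theorem one_sub_conj_mul_ne_zero {a z : ℂ} (ha : ‖a‖ < 1) (hz : ‖z‖ < 1) :
    1 - starRingEnd ℂ a * z ≠ 0 := fun h => by
  have : ‖starRingEnd ℂ a * z‖ = 1 := by rw [← sub_eq_zero.1 h, norm_one]
  rw [norm_mul, RCLike.norm_conj] at this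
  nlinarith [norm_nonneg a, norm_nonneg z]

theorem mobius_injective {a z w : ℂ} (ha : ‖a‖ < 1) (hz : ‖z‖ < 1) (hw : ‖w‖ < 1)
    (h : (z - a) / (1 - starRingEnd ℂ a * z) = (w - a) / (1 - starRingEnd ℂ a * w)) : z = w := by
  rw [div_eq_div_iff (one_sub_conj_mul_ne_zero ha hz) (one_sub_conj_mul_ne_zero ha hw)] at h
  have h1 : (1 - starRingEnd ℂ a * a) * (z - w) = 0 := by linear_combination h
  exact sub_eq_zero.1 ((mul_eq_zero.1 h1).resolve_left (one_sub_conj_mul_ne_zero ha ha))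

theorem differentiableOn_mobius {a : ℂ} (ha : ‖a‖ < 1) :
    DifferentiableOn ℂ (fun z => (z - a) / (1 - starRingEnd ℂ a * z)) (ball 0 1) := by
  refine DifferentiableOn.div (by fun_prop) (by fun_prop) fun z hz => ?_
  exact one_sub_conj_mul_ne_zero ha (by simpa using hz)

/-- The derivative of a Möbius map, composed with a function. -/
theorem hasDerivAt_mobius_comp {a d z : ℂ} {f : ℂ → ℂ} (ha : ‖a‖ < 1) (hz : ‖f z‖ < 1)
    (hf : HasDerivAt f d z) :
    HasDerivAt (fun w => (f w - a) / (1 - starRingEnd ℂ a * f w))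
      (d * (1 - starRingEnd ℂ a * a) / (1 - starRingEnd ℂ a * f z) ^ 2) z := by
  have h := (hf.sub_const a).div ((hf.const_mul (starRingEnd ℂ a)).const_sub 1)
    (one_sub_conj_mul_ne_zero ha hz)
  refine h.congr_deriv ?_
  congr 1
  ring

variable (P) in
/-- The competing functions of the extremal problem. -/
def Admissible (x₀ : X) (f : X → ℂ) : Prop :=
  P.Hol f ∧ (∀ x, ‖f x‖ < 1) ∧ f x₀ = 0 ∧ ∀ x y, f x = f y → P.p x = P.p y

/-- An admissible function that is not onto the disc does not have maximal derivative. -/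
theorem Admissible.exists_larger {x₀ : X}
    (hsqrt : ∀ g : X → ℂ, P.Hol g → (∀ x, g x ≠ 0) → ∃ h : X → ℂ, Continuous h ∧ ∀ x, h x ^ 2 = g x)
    {f : X → ℂ} (hf : P.Admissible x₀ f) (hd : P.der f x₀ ≠ 0) {a : ℂ} (ha : ‖a‖ < 1)
    (hfa : ∀ x, f x ≠ a) : ∃ g, P.Admissible x₀ g ∧ ‖P.der f x₀‖ < ‖P.der g x₀‖ := by
  obtain ⟨hhol, hlt, hx0, hfib⟩ := hf
  obtain ⟨h, hcont, hsq⟩ := hsqrt (fun x => (f x - a) / (1 - starRingEnd ℂ a * f x))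
    (hhol.comp (differentiableOn_mobius ha) fun x => by simpa using hlt x)
    (fun x => div_ne_zero (sub_ne_zero.2 (hfa x)) (one_sub_conj_mul_ne_zero ha (hlt x)))
  have hne : ∀ x, h x ≠ 0 := fun x hx => by
    have := hsq x
    rw [hx, zero_pow two_ne_zero] at this
    exact div_ne_zero (sub_ne_zero.2 (hfa x)) (one_sub_conj_mul_ne_zero ha (hlt x)) this.symm
  have hhh : P.Hol h := by
    refine Hol.of_sq hcont hne ?_
    rw [funext hsq]
    exact hhol.comp (differentiableOn_mobius ha) fun x => by simpa using hlt x
  have hhlt : ∀ x, ‖h x‖ < 1 := fun x => by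
    have h1 := norm_mobius_lt ha (hlt x)
    rw [← hsq x, norm_pow] at h1
    nlinarith [norm_nonneg (h x)]
  set b := h x₀ with hb
  have hb1 : ‖b‖ < 1 := hhlt x₀
  refine ⟨fun x => (h x - b) / (1 - starRingEnd ℂ b * h x), ⟨?_, ?_, ?_, ?_⟩, ?_⟩
  · exact hhh.comp (differentiableOn_mobius hb1) fun x => by simpa using hhlt x
  · exact fun x => norm_mobius_lt hb1 (hhlt x)
  · simp [hb]
  · intro x y hxy
    have h1 := mobius_injective hb1 (hhlt x) (hhlt y) hxy
    have h2 := hsq x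
    rw [h1, hsq y] at h2
    exact hfib x y (mobius_injective ha (hlt y) (hlt x) h2).symm
  · have hcx : h (P.c x₀ (P.p x₀)) = b := by rw [P.c_self]
    have hcf : f (P.c x₀ (P.p x₀)) = 0 := by rw [P.c_self, hx0]
    have d1 := (hhh.hasDerivAt x₀).pow 2
    have d2 := hasDerivAt_mobius_comp (f := f ∘ P.c x₀) ha (hlt _) (hhol.hasDerivAt x₀)
    have e1 : ((h ∘ P.c x₀) ^ 2) =
        fun w => ((f ∘ P.c x₀) w - a) / (1 - starRingEnd ℂ a * (f ∘ P.c x₀) w) := by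
      funext w; simp [hsq]
    rw [e1] at d1
    have e2 := d1.unique d2
    simp only [Function.comp, hcx, hcf, mul_zero, sub_zero, one_pow, div_one] at e2
    have d4 := hasDerivAt_mobius_comp (f := h ∘ P.c x₀) hb1 (hhlt _) (hhh.hasDerivAt x₀)
    have e3 : P.der (fun x => (h x - b) / (1 - starRingEnd ℂ b * h x)) x₀ =
        P.der h x₀ / (1 - starRingEnd ℂ b * b) := by
      have h5 := d4.deriv
      simp only [Function.comp_apply, hcx] at h5
      have h6 := one_sub_conj_mul_ne_zero hb1 hb1
      unfold der at h5 ⊢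
      change deriv (fun w => (h (P.c x₀ w) - b) / (1 - starRingEnd ℂ b * h (P.c x₀ w))) (P.p x₀) = _
      rw [h5]
      field_simp
    have hb0 : 0 < ‖b‖ := norm_pos_iff.2 (hne x₀)
    have hnb : ‖1 - starRingEnd ℂ b * b‖ = 1 - ‖b‖ ^ 2 := by
      rw [← Complex.normSq_eq_conj_mul_self, Complex.normSq_eq_norm_sq]
      rw [show (1 : ℂ) - ((‖b‖ ^ 2 : ℝ) : ℂ) = ((1 - ‖b‖ ^ 2 : ℝ) : ℂ) by push_cast; ring]
      rw [Complex.norm_real, Real.norm_of_nonneg (by nlinarith)]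
    have hna : ‖1 - starRingEnd ℂ a * a‖ = 1 - ‖a‖ ^ 2 := by
      rw [← Complex.normSq_eq_conj_mul_self, Complex.normSq_eq_norm_sq]
      rw [show (1 : ℂ) - ((‖a‖ ^ 2 : ℝ) : ℂ) = ((1 - ‖a‖ ^ 2 : ℝ) : ℂ) by push_cast; ring]
      rw [Complex.norm_real, Real.norm_of_nonneg (by nlinarith [norm_nonneg a])]
    have hab : ‖a‖ = ‖b‖ ^ 2 := by
      have := hsq x₀
      rw [hx0] at this
      rw [← norm_pow, hb, this]; simp
    have hn := congrArg norm e2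
    rw [norm_mul, norm_mul, norm_mul, hna, hab] at hn
    norm_num at hn
    rw [e3, norm_div, hnb, lt_div_iff₀ (by nlinarith)]
    have hfd : 0 < ‖P.der f x₀‖ := norm_pos_iff.2 hd
    have h7 : 2 * ‖b‖ * ‖P.der h x₀‖ =
        ‖P.der f x₀‖ * (1 - ‖b‖ ^ 2) * (1 + ‖b‖ ^ 2) := by
      linear_combination hn
    have h8 : 2 * ‖b‖ < 1 + ‖b‖ ^ 2 := by nlinarith
    have h9 : 0 < ‖P.der f x₀‖ * (1 - ‖b‖ ^ 2) := mul_pos hfd (by nlinarith)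
    have h10 : ‖P.der f x₀‖ * (1 - ‖b‖ ^ 2) * (2 * ‖b‖) < 2 * ‖b‖ * ‖P.der h x₀‖ := by
      rw [h7]; exact mul_lt_mul_of_pos_left h8 h9
    nlinarith

end PlaneSpread

end

section

namespace PlaneSpread

open Metric

variable {X : Type*} [TopologicalSpace X] {P : PlaneSpread X}

theorem Admissible.ultrafilter_limit [PreconnectedSpace X] {ι : Type*} (u : Ultrafilter ι) {x₀ : X}
    {g : ι → X → ℂ} {G : X → ℂ} (hg : ∀ n, P.Admissible x₀ (g n))
    (hG : ∀ x, Tendsto (fun n => g n x) u (𝓝 (G x))) (hd : P.der G x₀ ≠ 0) :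
    P.Admissible x₀ G := by
  have hhol : P.Hol G :=
    (Hol.ultrafilter_limit u (fun n => (hg n).1) (fun n x => ((hg n).2.1 x).le) hG).1
  have hle : ∀ x, ‖G x‖ ≤ 1 := fun x =>
    le_of_tendsto (hG x).norm (Eventually.of_forall fun n => ((hg n).2.1 x).le)
  refine ⟨hhol, fun x => lt_of_le_of_ne (hle x) fun h1 => ?_, ?_, fun x y hxy => ?_⟩
  · refine hhol.not_eventually_const hd x (a := G x) ?_
    have := Complex.eventually_eq_of_isLocalMax_norm (f := G ∘ P.c x) (c := P.p x)
      ((hhol x).1.eventually_differentiableAt (ball_nhds x)) (Eventually.of_forall fun w => by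
        simp only [Function.comp_apply, P.c_self, h1]
        exact hle _)
    simpa [P.c_self] using this
  · refine tendsto_nhds_unique (hG x₀) ?_
    simp [(hg _).2.2.1]
  · by_contra hne
    set δ := min (P.ε x) (dist (P.p x) (P.p y)) with hδ
    have hδ0 : 0 < δ := lt_min (P.ε_pos x) (dist_pos.2 hne)
    have hsub : ball (P.p x) δ ⊆ ball (P.p x) (P.ε x) := ball_subset_ball (min_le_left _ _)
    have h0 := eventually_eq_zero_of_ultrafilter_limit u (c := P.p x) (r := δ)
      (g := fun n w => (g n (P.c x w) - g n y) / 2) (G := fun w => (G (P.c x w) - G y) / 2) hδ0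
      (fun n => ((((hg n).1 x).1.mono hsub).sub_const _).div_const _)
      (fun n w hw => by
        rw [norm_div, div_le_one (by simp)]
        have := norm_sub_le (g n (P.c x w)) (g n y)
        simp only [Complex.norm_ofNat]
        linarith [(hg n).2.1 (P.c x w), (hg n).2.1 y])
      (fun w hw => ((hG _).sub (hG y)).div_const _)
      (fun n w hw h => by
        have h1 : g n (P.c x w) = g n y := by
          have := (div_eq_zero_iff.1 h).resolve_right two_ne_zero
          exact sub_eq_zero.1 this
        have h2 := (hg n).2.2.2 _ _ h1
        rw [P.p_c x w (hsub hw)] at h2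
        rw [mem_ball, h2, dist_comm] at hw
        exact absurd hw (not_lt.2 (min_le_right _ _)))
      (by simp [P.c_self, hxy])
    refine hhol.not_eventually_const hd x (a := G y) ?_
    filter_upwards [h0] with w hw
    exact sub_eq_zero.1 ((div_eq_zero_iff.1 hw).resolve_right two_ne_zero)

/-- Uniformization of a connected bounded spread on which nonvanishing holomorphic functions have
square roots. -/
theorem exists_uniformization [PreconnectedSpace X] (x₀ : X) {B : ℝ} (hB : ∀ x, ‖P.p x‖ ≤ B)
    (hsqrt : ∀ g : X → ℂ, P.Hol g → (∀ x, g x ≠ 0) →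
      ∃ h : X → ℂ, Continuous h ∧ ∀ x, h x ^ 2 = g x) :
    ∃ f : X → ℂ, P.Hol f ∧ (∀ x, ‖f x‖ < 1) ∧ (∀ z : ℂ, ‖z‖ < 1 → ∃ x, f x = z) ∧
      ∀ x y, f x = f y → P.p x = P.p y := by
  set S : Set ℝ := {d | ∃ f, P.Admissible x₀ f ∧ d = ‖P.der f x₀‖} with hS
  have hbdd : BddAbove S := by
    refine ⟨2 / P.ε x₀, ?_⟩
    rintro d ⟨f, hf, rfl⟩
    exact norm_deriv_le_of_bounded (P.ε_pos x₀) (hf.1 x₀).1 fun w _ => (hf.2.1 _).le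
  have hB0 : 0 ≤ B := (norm_nonneg _).trans (hB x₀)
  obtain ⟨f₀, hf₀, hf₀d⟩ : ∃ f, P.Admissible x₀ f ∧ 0 < ‖P.der f x₀‖ := by
    have hK : (0 : ℝ) < 2 * B + 1 := by linarith
    have hKc : ((2 * B + 1 : ℝ) : ℂ) ≠ 0 := Complex.ofReal_ne_zero.2 hK.ne'
    have hhol : P.Hol fun x => (P.p x - P.p x₀) / ((2 * B + 1 : ℝ) : ℂ) :=
      hol_p.comp (g := fun z => (z - P.p x₀) / ((2 * B + 1 : ℝ) : ℂ)) (s := univ) (by fun_prop)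
        fun _ => mem_univ _
    refine ⟨_, ⟨hhol, fun x => ?_, by simp, fun x y hxy => ?_⟩, ?_⟩
    · rw [norm_div, Complex.norm_real, Real.norm_of_nonneg hK.le, div_lt_one hK]
      linarith [norm_sub_le (P.p x) (P.p x₀), hB x, hB x₀]
    · exact sub_left_injective ((div_left_inj' hKc).1 hxy)
    · rw [norm_pos_iff]
      have h1 : HasDerivAt (fun w => (w - P.p x₀) / ((2 * B + 1 : ℝ) : ℂ))
          (1 / ((2 * B + 1 : ℝ) : ℂ)) (P.p x₀) :=
        ((hasDerivAt_id _).sub_const _).div_const _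
      have h2 : (fun x => (P.p x - P.p x₀) / ((2 * B + 1 : ℝ) : ℂ)) ∘ P.c x₀ =ᶠ[𝓝 (P.p x₀)]
          fun w => (w - P.p x₀) / ((2 * B + 1 : ℝ) : ℂ) := by
        filter_upwards [ball_nhds x₀] with w hw
        simp [P.p_c x₀ w hw]
      unfold der
      rw [h2.deriv_eq, h1.deriv]
      exact one_div_ne_zero hKc
  have hmem : ‖P.der f₀ x₀‖ ∈ S := ⟨f₀, hf₀, rfl⟩
  have hSpos : 0 < sSup S := hf₀d.trans_le (le_csSup hbdd hmem)
  have hseq : ∀ n : ℕ, ∃ f, P.Admissible x₀ f ∧ sSup S - 1 / ((n : ℝ) + 1) < ‖P.der f x₀‖ := by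
    intro n
    obtain ⟨_, ⟨f, hf, rfl⟩, hlt⟩ := exists_lt_of_lt_csSup ⟨_, hmem⟩
      (show sSup S - 1 / ((n : ℝ) + 1) < sSup S by
        have : (0 : ℝ) < 1 / ((n : ℝ) + 1) := by positivity
        linarith)
    exact ⟨f, hf, hlt⟩
  choose g hg hgd using hseq
  set u : Ultrafilter ℕ := hyperfilter ℕ with hu
  have hlim : ∀ x, ∃ a, Tendsto (fun n => g n x) u (𝓝 a) := fun x => by
    obtain ⟨a, -, ha⟩ := (isCompact_closedBall (0 : ℂ) 1).ultrafilter_le_nhds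
      (u.map fun n => g n x) (by
        rw [le_principal_iff]
        refine Ultrafilter.mem_map.2 (Eventually.of_forall fun n => ?_)
        simpa using ((hg n).2.1 x).le)
    exact ⟨a, ha⟩
  choose G hG using hlim
  have hder := (Hol.ultrafilter_limit u (fun n => (hg n).1) (fun n x => ((hg n).2.1 x).le) hG).2 x₀
  have hge : sSup S ≤ ‖P.der G x₀‖ := by
    have h1 : Tendsto (fun n : ℕ => sSup S - 1 / ((n : ℝ) + 1)) u (𝓝 (sSup S - 0)) :=
      (tendsto_const_nhds.sub tendsto_one_div_add_atTop_nhds_zero_nat).mono_left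
        (Nat.hyperfilter_le_atTop)
    rw [sub_zero] at h1
    exact le_of_tendsto_of_tendsto' h1 hder.norm fun n => (hgd n).le
  have hGd : P.der G x₀ ≠ 0 := norm_pos_iff.1 (hSpos.trans_le hge)
  have hGa := Admissible.ultrafilter_limit u hg hG hGd
  refine ⟨G, hGa.1, hGa.2.1, fun z hz => ?_, hGa.2.2.2⟩
  by_contra hno
  push Not at hno
  obtain ⟨k, hk, hlt⟩ := hGa.exists_larger hsqrt hGd hz hno
  exact absurd (le_csSup hbdd ⟨k, hk, rfl⟩) (not_le.2 (hge.trans_lt hlt))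

end PlaneSpread

end

section

open Metric in
/-- A uniformization of a spread induces a locally univalent map of the disc. -/
theorem PlaneSpread.exists_locally_univalent {X : Type*} [TopologicalSpace X] {P : PlaneSpread X}
    {f : X → ℂ} (hf : P.Hol f) (hsurj : ∀ z : ℂ, ‖z‖ < 1 → ∃ x, f x = z)
    (hfib : ∀ x y, f x = f y → P.p x = P.p y) :
    ∃ q : ℂ → ℂ, DifferentiableOn ℂ q (ball 0 1) ∧ (∀ z ∈ ball (0 : ℂ) 1, deriv q z ≠ 0) ∧
      ∀ x, q (f x) = P.p x := by
  have hex : ∀ z : ℂ, ∃ v : ℂ, ∀ x, f x = z → P.p x = v := fun z => by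
    by_cases h : ∃ x, f x = z
    · obtain ⟨x, rfl⟩ := h
      exact ⟨P.p x, fun y hy => hfib y x hy⟩
    · exact ⟨0, fun x hx => absurd ⟨x, hx⟩ h⟩
  choose q hq using hex
  have hqf : ∀ x, q (f x) = P.p x := fun x => (hq _ x rfl).symm
  have key : ∀ x, ∃ d, d ≠ 0 ∧ HasDerivAt q d (f x) := fun x => by
    set u := f ∘ P.c x with hu
    have hux : u (P.p x) = f x := by simp [hu, P.c_self]
    have hqu : ∀ w ∈ ball (P.p x) (P.ε x), q (u w) = w := fun w hw => by
      simp only [hu, Function.comp_apply, hqf, P.p_c x w hw]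
    have hinj : InjOn u (ball (P.p x) (P.ε x)) := fun w hw w' hw' h => by
      rw [← hqu w hw, h, hqu w' hw']
    have hne : deriv u (P.p x) ≠ 0 := deriv_ne_zero_of_injOn_ball (P.ε_pos x) (hf x).1 hinj
    have hst : HasStrictDerivAt u (deriv u (P.p x)) (P.p x) :=
      ((hf x).1.analyticAt (PlaneSpread.ball_nhds x)).hasStrictDerivAt
    have hmap : map u (𝓝 (P.p x)) = 𝓝 (f x) := by rw [hst.map_nhds_eq hne, hux]
    refine ⟨(deriv u (P.p x))⁻¹, inv_ne_zero hne, ?_⟩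
    refine HasDerivAt.of_local_left_inverse (f := u) ?_ ?_ hne ?_
    · rw [ContinuousAt, ← hmap, tendsto_map'_iff, hqf]
      refine tendsto_id.congr' ?_
      filter_upwards [PlaneSpread.ball_nhds x] with w hw
      exact (hqu w hw).symm
    · rw [hqf]; exact hst.hasDerivAt
    · rw [← hmap, eventually_map]
      filter_upwards [PlaneSpread.ball_nhds x] with w hw
      rw [hqu w hw]
  refine ⟨q, fun z hz => ?_, fun z hz => ?_, hqf⟩ <;>
    obtain ⟨x, rfl⟩ := hsurj z (by simpa using hz) <;> obtain ⟨d, hd0, hd⟩ := key x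
  · exact hd.differentiableAt.differentiableWithinAt
  · rwa [hd.deriv]

open Metric in
theorem isLocalHomeomorph_of_deriv_ne_zero {q : ℂ → ℂ} (hq : DifferentiableOn ℂ q (ball 0 1))
    (hd : ∀ z ∈ ball (0 : ℂ) 1, deriv q z ≠ 0) :
    IsLocalHomeomorph (fun z : ball (0 : ℂ) 1 => q z) := by
  have h1 : IsLocalHomeomorphOn q (ball 0 1) := by
    refine IsLocalHomeomorphOn.mk _ _ fun z hz => ?_
    have hst : HasStrictDerivAt q (deriv q z) z :=
      (hq.analyticAt (isOpen_ball.mem_nhds hz)).hasStrictDerivAt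
    have hst' := hst.hasStrictFDerivAt_equiv (hd z hz)
    exact ⟨hst'.toOpenPartialHomeomorph q, hst'.mem_toOpenPartialHomeomorph_source, fun _ _ => rfl⟩
  exact (isLocalHomeomorph_iff_isLocalHomeomorphOn_univ.2
    (h1.comp (g := q) (f := ((↑) : ball (0 : ℂ) 1 → ℂ))
      (isLocalHomeomorph_iff_isLocalHomeomorphOn_univ.1
        isOpen_ball.isOpenEmbedding_subtypeVal.isLocalHomeomorph)
      fun z _ => z.2))

/-- A continuous lift of a holomorphic function through a locally univalent map is holomorphic. -/
theorem differentiableAt_of_comp {q S r : ℂ → ℂ} {z : ℂ} (hS : ContinuousAt S z)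
    (hq : AnalyticAt ℂ q (S z)) (hd : deriv q (S z) ≠ 0) (hr : DifferentiableAt ℂ r z)
    (h : ∀ᶠ w in 𝓝 z, q (S w) = r w) : DifferentiableAt ℂ S z := by
  have hst := hq.hasStrictDerivAt
  set k := hst.localInverse _ _ _ hd with hk
  have hleft : ∀ᶠ w in 𝓝 (S z), k (q w) = w := hst.eventually_left_inverse hd
  have hkd : DifferentiableAt ℂ k (r z) := by
    rw [← h.self_of_nhds]
    exact (hst.to_localInverse hd).hasDerivAt.differentiableAt
  refine (hkd.comp z hr).congr_of_eventuallyEq ?_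
  filter_upwards [hS.eventually hleft, h] with w h1 h2
  rw [Function.comp_apply, ← h2, h1]

end

section

open scoped unitInterval

/-- A nonvanishing continuous function on a simply connected space has a logarithm. -/
theorem exists_continuous_log {A : Type*} [TopologicalSpace A] [SimplyConnectedSpace A]
    [LocallyPathConnectedSpace A] {g : A → ℂ} (hg : Continuous g) (h0 : ∀ a, g a ≠ 0) :
    ∃ h : A → ℂ, Continuous h ∧ ∀ a, Complex.exp (h a) = g a := by
  obtain ⟨a₀⟩ : Nonempty A := inferInstance
  obtain ⟨F, ⟨-, hF⟩, -⟩ := Complex.isCoveringMapOn_exp.existsUnique_continuousMap_lifts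
    (f := (⟨g, hg⟩ : C(A, ℂ))) (a₀ := a₀) (e₀ := Complex.log (g a₀))
    (Complex.exp_log (h0 a₀)) (fun a => by simpa using h0 a)
  exact ⟨F, F.continuous, fun a => congrFun hF a⟩

namespace BasedPath

/-- The straight path from `0` to `1`. -/
def ramp : C(I, ℂ) := ⟨fun t => ((t : ℝ) : ℂ), by fun_prop⟩

theorem norm_ramp_le : ‖ramp‖ ≤ 1 := by
  rw [ContinuousMap.norm_le _ zero_le_one]
  intro t
  change ‖((t : ℝ) : ℂ)‖ ≤ 1
  rw [Complex.norm_real, Real.norm_of_nonneg t.2.1]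
  exact t.2.2

variable (Ω : Set ℂ) (z₀ : ℂ)

/-- The paths that stay in `Ω` when translated so as to start at `z₀`. -/
def inside : Set C(I, ℂ) := {γ | ∀ t, z₀ + γ t - γ 0 ∈ Ω}

variable {Ω z₀}

theorem isOpen_inside (hΩ : IsOpen Ω) : IsOpen (inside Ω z₀) := by
  have h1 : IsOpen {γ : C(I, ℂ) | MapsTo γ univ Ω} :=
    ContinuousMap.isOpen_setOfPred_mapsTo isCompact_univ hΩ
  have h2 : Continuous fun γ : C(I, ℂ) =>
      ContinuousMap.const I z₀ + γ - ContinuousMap.const I (γ 0) :=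
    (continuous_const.add continuous_id).sub
      (ContinuousMap.continuous_const'.comp (continuous_eval_const 0))
  convert h1.preimage h2 using 1
  ext γ
  simp [inside, MapsTo]

/-- The path run only up to time `s`. -/
def shrink (s : I) (γ : C(I, ℂ)) : C(I, ℂ) := ⟨fun t => γ (s * t), by fun_prop⟩

@[simp] theorem shrink_apply (s : I) (γ : C(I, ℂ)) (t : I) : shrink s γ t = γ (s * t) := rfl

theorem continuous_shrink : Continuous fun p : I × C(I, ℂ) => shrink p.1 p.2 := by
  refine ContinuousMap.continuous_of_continuous_uncurry _ ?_
  change Continuous fun q : (I × C(I, ℂ)) × I => q.1.2 (q.1.1 * q.2)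
  fun_prop

theorem shrink_mem {γ : C(I, ℂ)} (hγ : γ ∈ inside Ω z₀) (s : I) : shrink s γ ∈ inside Ω z₀ :=
  fun t => by
    rw [shrink_apply, shrink_apply, mul_zero]
    exact hγ (s * t)

theorem sub_const_mem {γ : C(I, ℂ)} (hγ : γ ∈ inside Ω z₀) (a : ℂ) :
    γ - ContinuousMap.const I a ∈ inside Ω z₀ := fun t => by
  convert hγ t using 1
  simp only [ContinuousMap.sub_apply, ContinuousMap.const_apply]
  ring

theorem contractibleSpace_inside (h0 : z₀ ∈ Ω) : ContractibleSpace (inside Ω z₀) := by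
  rw [contractible_iff_id_nullhomotopic]
  have hz : (0 : C(I, ℂ)) ∈ inside Ω z₀ := fun t => by simpa using h0
  refine ⟨⟨0, hz⟩, ⟨ContinuousMap.Homotopy.symm
    ⟨⟨fun p => ⟨shrink p.1 p.2.1 - ContinuousMap.const I ((1 - (p.1 : ℝ)) * p.2.1 0),
      sub_const_mem (shrink_mem p.2.2 p.1) _⟩, ?_⟩, ?_, ?_⟩⟩⟩
  · refine Continuous.subtype_mk (Continuous.sub (continuous_shrink.comp
      (continuous_fst.prodMk (continuous_subtype_val.comp continuous_snd)))
      (ContinuousMap.continuous_const'.comp ?_)) _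
    have : Continuous fun p : I × inside Ω z₀ => p.2.1 0 :=
      (continuous_eval_const (0 : I)).comp
        (continuous_subtype_val.comp continuous_snd)
    fun_prop
  · intro γ
    ext t
    simp
  · intro γ
    ext t
    simp

/-- The endpoint of a path. -/
def endpoint (z₀ : ℂ) (γ : C(I, ℂ)) : ℂ := z₀ + γ 1 - γ 0

theorem continuous_endpoint : Continuous (endpoint z₀) := by
  exact (continuous_const.add (continuous_eval_const 1)).sub
    (continuous_eval_const 0)

theorem endpoint_add_smul_ramp (γ : C(I, ℂ)) (a : ℂ) :
    endpoint z₀ (γ + a • ramp) = endpoint z₀ γ + a := by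
  simp [endpoint, ramp]
  ring

open Classical in
/-- The straight local section of the endpoint map. -/
def localSection (x : inside Ω z₀) (w : ℂ) : inside Ω z₀ :=
  if h : x.1 + (w - endpoint z₀ x.1) • ramp ∈ inside Ω z₀ then ⟨_, h⟩ else x

open Metric in
theorem dist_section_le (x : C(I, ℂ)) (w : ℂ) :
    dist (x + (w - endpoint z₀ x) • ramp) x ≤ dist w (endpoint z₀ x) := by
  rw [dist_eq_norm, add_sub_cancel_left, norm_smul, dist_eq_norm]
  exact mul_le_of_le_one_right (norm_nonneg _) norm_ramp_le

open Metric in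
/-- The space of paths in `Ω` starting at `z₀`, spread over the plane by the endpoint map. -/
theorem exists_spread (hΩ : IsOpen Ω) :
    ∃ P : PlaneSpread (inside Ω z₀), ∀ x, P.p x = endpoint z₀ x.1 := by
  have hε : ∀ x : inside Ω z₀, ∃ ε > 0, ball x.1 ε ⊆ inside Ω z₀ := fun x =>
    Metric.isOpen_iff.1 (isOpen_inside hΩ) x.1 x.2
  choose ε hε0 hεs using hε
  have hmem : ∀ x : inside Ω z₀, ∀ w ∈ ball (endpoint z₀ x.1) (ε x),
      x.1 + (w - endpoint z₀ x.1) • ramp ∈ ball x.1 (ε x) := fun x w hw =>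
    (dist_section_le x.1 w).trans_lt hw
  have hsec : ∀ x : inside Ω z₀, ∀ w ∈ ball (endpoint z₀ x.1) (ε x),
      (localSection x w).1 = x.1 + (w - endpoint z₀ x.1) • ramp := fun x w hw => by
    rw [localSection, dif_pos (hεs x (hmem x w hw))]
  refine ⟨{ p := fun x => endpoint z₀ x.1
            c := localSection
            ε := ε
            U := fun x => {y | y.1 ∈ ball x.1 (ε x) ∧ endpoint z₀ y.1 ∈ ball (endpoint z₀ x.1) (ε x)}
            p_cont := continuous_endpoint.comp continuous_subtype_val
            ε_pos := hε0
            U_nhds := ?_, c_cont := ?_, c_self := ?_, c_mem := ?_, p_c := ?_, p_U := ?_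
            fiber := ?_ }, fun x => rfl⟩
  · intro x
    have h1 : Continuous fun y : inside Ω z₀ => endpoint z₀ y.1 :=
      continuous_endpoint.comp continuous_subtype_val
    exact ((isOpen_ball.preimage continuous_subtype_val).inter (isOpen_ball.preimage h1)).mem_nhds
      ⟨mem_ball_self (hε0 x), mem_ball_self (hε0 x)⟩
  · intro x
    rw [Topology.IsInducing.subtypeVal.continuousOn_iff]
    refine ContinuousOn.congr (f := fun w => x.1 + (w - endpoint z₀ x.1) • ramp) (by fun_prop) ?_
    intro w hw
    exact hsec x w hw
  · intro x
    apply Subtype.ext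
    rw [hsec x _ (mem_ball_self (hε0 x)), sub_self]
    ext t
    change x.1 t + 0 * ramp t = x.1 t
    ring
  · intro x w hw
    change _ ∧ endpoint z₀ _ ∈ _
    rw [hsec x w hw, endpoint_add_smul_ramp]
    exact ⟨hmem x w hw, by simpa using hw⟩
  · intro x w hw
    rw [hsec x w hw, endpoint_add_smul_ramp]
    ring
  · intro x y hy
    exact hy.2
  · intro x w
    rw [← Topology.IsInducing.subtypeVal.isPreconnected_image]
    by_cases hw : w ∈ ball (endpoint z₀ x.1) (ε x)
    · have : Subtype.val '' ({y : inside Ω z₀ | y.1 ∈ ball x.1 (ε x) ∧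
          endpoint z₀ y.1 ∈ ball (endpoint z₀ x.1) (ε x)} ∩
          (fun x => endpoint z₀ x.1) ⁻¹' {w}) = ball x.1 (ε x) ∩ endpoint z₀ ⁻¹' {w} := by
        ext y
        constructor
        · rintro ⟨y, ⟨h1, h2⟩, rfl⟩
          exact ⟨h1.1, h2⟩
        · rintro ⟨h1, h2⟩
          refine ⟨⟨y, hεs x h1⟩, ⟨⟨h1, ?_⟩, h2⟩, rfl⟩
          simp only [mem_preimage, mem_singleton_iff] at h2
          simpa [h2] using hw
      rw [this]
      refine ((convex_ball _ _).inter (𝕜 := ℝ) ?_).isPreconnected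
      intro a ha b hb s t hs ht hst
      simp only [mem_preimage, mem_singleton_iff, endpoint] at ha hb ⊢
      have e (u : I) : (s • a + t • b : C(I, ℂ)) u = s • a u + t • b u := rfl
      rw [e, e]
      have hst' : (s : ℂ) + t = 1 := by exact_mod_cast hst
      simp only [Complex.real_smul]
      linear_combination (s : ℂ) * ha + (t : ℂ) * hb + (w - z₀) * hst'
    · convert isPreconnected_empty
      rw [eq_empty_iff_forall_notMem]
      rintro _ ⟨y, ⟨h1, h2⟩, rfl⟩
      simp only [mem_preimage, mem_singleton_iff] at h2
      exact hw (h2 ▸ h1.2)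

end BasedPath

open Metric in
/-- Existence of a holomorphic universal covering, with the path lifting property. -/
theorem exists_holomorphic_covering {Ω : Set ℂ} (hΩ : IsOpen Ω) {B : ℝ}
    (hB : ∀ z ∈ Ω, ‖z‖ ≤ B) {z₀ : ℂ} (h0 : z₀ ∈ Ω) :
    ∃ q : ℂ → ℂ, DifferentiableOn ℂ q (ball 0 1) ∧ (∀ z ∈ ball (0 : ℂ) 1, deriv q z ≠ 0) ∧
      (∀ z ∈ ball (0 : ℂ) 1, q z ∈ Ω) ∧ (∃ e ∈ ball (0 : ℂ) 1, q e = z₀) ∧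
      ∀ (e : ball (0 : ℂ) 1) (Γ : C(I, ℂ)), (∀ t, Γ t ∈ Ω) → Γ 0 = q e →
        ∃ L : C(I, ball (0 : ℂ) 1), L 0 = e ∧ ∀ t, q (L t) = Γ t := by
  obtain ⟨P, hP⟩ := BasedPath.exists_spread (z₀ := z₀) hΩ
  have hcontr := BasedPath.contractibleSpace_inside h0
  have hlpc : LocallyPathConnectedSpace (BasedPath.inside Ω z₀) :=
    (BasedPath.isOpen_inside hΩ).locallyPathConnectedSpace
  have hz : (0 : C(I, ℂ)) ∈ BasedPath.inside Ω z₀ := fun t => by simpa using h0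
  obtain ⟨f, hf, hlt, hsurj, hfib⟩ := PlaneSpread.exists_uniformization (P := P) ⟨0, hz⟩ (B := B)
    (fun x => by rw [hP]; exact hB _ (x.2 1)) (fun g hg hg0 => by
      obtain ⟨h, hc, he⟩ := exists_continuous_log hg.continuous hg0
      refine ⟨fun x => Complex.exp (h x / 2), by fun_prop, fun x => ?_⟩
      rw [← Complex.exp_nat_mul, ← he]
      congr 1
      push_cast; ring)
  obtain ⟨q, hq, hqd, hqf⟩ := PlaneSpread.exists_locally_univalent hf hsurj hfib
  refine ⟨q, hq, hqd, fun z hz => ?_, ⟨f ⟨0, hz⟩, by simpa using hlt _, ?_⟩, ?_⟩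
  · obtain ⟨x, rfl⟩ := hsurj z (by simpa using hz)
    rw [hqf, hP]
    exact x.2 1
  · rw [hqf, hP]; simp [BasedPath.endpoint]
  intro e Γ hΓ hΓ0
  obtain ⟨x, hx⟩ := hsurj e (by exact mem_ball_zero_iff.1 e.2)
  have hpx : z₀ + x.1 1 - x.1 0 = q e := by rw [← hx, hqf, hP]; rfl
  let α : Path z₀ (q e) := ⟨ContinuousMap.const I z₀ + x.1 - ContinuousMap.const I (x.1 0),
    by simp, by simpa using hpx⟩
  have hα (t : I) : α t = z₀ + x.1 t - x.1 0 := rfl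
  let β : Path (q e) (Γ 1) := ⟨Γ, hΓ0, rfl⟩
  let y : Path z₀ (Γ 1) := α.trans β
  have hymem : ∀ t, y t ∈ Ω := fun t => by
    have : y t ∈ range y := mem_range_self t
    rw [Path.trans_range] at this
    rcases this with ⟨s, hs⟩ | ⟨s, hs⟩
    · rw [← hs]; exact x.2 s
    · rw [← hs]; exact hΓ s
  let y' : C(I, ℂ) := y + ContinuousMap.const I (x.1 0 - z₀)
  have hy' : ∀ t, y' t = y t + (x.1 0 - z₀) := fun t => rfl
  have hy'0 : y' 0 = x.1 0 := by rw [hy', y.source]; ring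
  have hy'm : y' ∈ BasedPath.inside Ω z₀ := fun t => by
    rw [hy'0, hy']
    convert hymem t using 1
    ring
  let half : I → I := fun s => ⟨(1 + (s : ℝ)) / 2, by
    constructor <;> linarith [s.2.1, s.2.2]⟩
  have hhalf : Continuous half := Continuous.subtype_mk (by fun_prop) _
  let m : I → BasedPath.inside Ω z₀ := fun s =>
    ⟨BasedPath.shrink (half s) y', BasedPath.shrink_mem hy'm _⟩
  have hm : Continuous m := Continuous.subtype_mk
    (BasedPath.continuous_shrink.comp (hhalf.prodMk continuous_const)) _
  have hfm (s : I) : f (m s) ∈ ball (0 : ℂ) 1 := mem_ball_zero_iff.2 (hlt _)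
  refine ⟨⟨fun s => ⟨f (m s), hfm s⟩, (hf.continuous.comp hm).subtype_mk hfm⟩, ?_, ?_⟩
  · apply Subtype.ext
    change f (m 0) = e
    rw [← hx]
    congr 1
    apply Subtype.ext
    ext u
    change y' (half 0 * u) = x.1 u
    rw [hy', Path.trans_apply, dif_pos (by
      change (1 + ((0 : I) : ℝ)) / 2 * (u : ℝ) ≤ 1 / 2
      have h1 : (u : ℝ) ≤ 1 := u.2.2
      have h2 : ((0 : I) : ℝ) = 0 := rfl
      rw [h2]; linarith), hα]
    have : (⟨2 * ((half 0 * u : I) : ℝ), by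
        change 2 * ((1 + ((0 : I) : ℝ)) / 2 * (u : ℝ)) ∈ I
        simp⟩ : I) = u := by
      apply Subtype.ext
      change 2 * ((1 + ((0 : I) : ℝ)) / 2 * (u : ℝ)) = u
      simp
    rw [this]
    ring
  · intro t
    change q (f (m t)) = Γ t
    rw [hqf, hP]
    change z₀ + y' (half t * 1) - y' (half t * 0) = Γ t
    rw [mul_one, mul_zero, hy'0, hy']
    have : y (half t) = Γ t := by
      rw [Path.trans_apply]
      split_ifs with h
      · have h1 : (1 + (t : ℝ)) / 2 ≤ 1 / 2 := h
        have ht : t = 0 := Subtype.ext (le_antisymm (by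
          change (t : ℝ) ≤ 0
          linarith) t.2.1)
        subst ht
        rw [hΓ0]
        refine Eq.trans ?_ α.target
        congr 1
        apply Subtype.ext
        change 2 * ((1 + ((0 : I) : ℝ)) / 2) = ((1 : I) : ℝ)
        simp
      · change Γ _ = Γ t
        congr 1
        apply Subtype.ext
        change 2 * ((1 + (t : ℝ)) / 2) - 1 = (t : ℝ)
        ring
    rw [this]
    ring

end

section

open Metric MeasureTheory

theorem dslope_comm {𝕜 E : Type*} [NontriviallyNormedField 𝕜] [NormedAddCommGroup E]
    [NormedSpace 𝕜 E] (f : 𝕜 → E) (a b : 𝕜) : dslope f a b = dslope f b a := by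
  rcases eq_or_ne a b with rfl | h
  · rfl
  · rw [dslope_of_ne _ h, dslope_of_ne _ h.symm, slope_comm]

/-- The divided difference of a holomorphic function is jointly continuous. -/
theorem continuousOn_dslope_uncurry {f : ℂ → ℂ} {U : Set ℂ} (hU : IsOpen U)
    (hf : DifferentiableOn ℂ f U) : ContinuousOn (fun p : ℂ × ℂ => dslope f p.1 p.2) (U ×ˢ U) := by
  rintro ⟨a, b⟩ ⟨ha, hb⟩
  apply ContinuousAt.continuousWithinAt
  have hca : ContinuousAt f a := (hf.differentiableAt (hU.mem_nhds ha)).continuousAt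
  have hcb : ContinuousAt f b := (hf.differentiableAt (hU.mem_nhds hb)).continuousAt
  rcases eq_or_ne a b with rfl | h
  · have han : AnalyticAt ℂ f a := hf.analyticAt (hU.mem_nhds ha)
    have h1 := han.hasStrictDerivAt
    have h2 : ContinuousAt (deriv f) a := han.deriv.continuousAt
    rw [Metric.continuousAt_iff'] at h2 ⊢
    intro ε hε
    have h3 := (hasStrictDerivAt_iff_hasStrictFDerivAt.1 h1).isLittleO.bound (half_pos hε)
    have h4 : ∀ᶠ p : ℂ × ℂ in 𝓝 (a, a), dist (deriv f p.1) (deriv f a) < ε :=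
      (continuousAt_fst (p := (a, a))).eventually (h2 ε hε)
    filter_upwards [h3, h4] with p hp3 hp4
    rw [dslope_same]
    rcases eq_or_ne p.1 p.2 with he | he
    · rw [← he, dslope_same]; exact hp4
    · rw [dslope_comm, dslope_of_ne _ he, slope_def_field, dist_eq_norm]
      have hne : p.1 - p.2 ≠ 0 := sub_ne_zero.2 he
      have : (f p.1 - f p.2) / (p.1 - p.2) - deriv f a =
          (f p.1 - f p.2 - (p.1 - p.2) • deriv f a) / (p.1 - p.2) := by
        rw [smul_eq_mul]; field_simp
      rw [this, norm_div]
      calc _ ≤ ε / 2 := by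
            rw [div_le_iff₀ (norm_pos_iff.2 hne)]
            exact hp3
        _ < ε := half_lt_self hε
  · have h1 : ContinuousAt (fun p : ℂ × ℂ => (p.2 - p.1)⁻¹ • (f p.2 - f p.1)) (a, b) := by
      have hs : ContinuousAt (fun p : ℂ × ℂ => p.2 - p.1) (a, b) := by fun_prop
      refine ContinuousAt.smul (hs.inv₀ (sub_ne_zero.2 h.symm)) ?_
      exact (ContinuousAt.comp (f := Prod.snd) (x := (a, b)) hcb continuousAt_snd).sub
        (ContinuousAt.comp (f := Prod.fst) (x := (a, b)) hca continuousAt_fst)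
    refine h1.congr ?_
    have : ∀ᶠ p : ℂ × ℂ in 𝓝 (a, b), p.1 ≠ p.2 :=
      (isOpen_ne_fun continuous_fst continuous_snd).mem_nhds h
    filter_upwards [this] with p hp
    rw [dslope_of_ne _ hp.symm]
    rfl

/-- An integral depending on a complex parameter is holomorphic if the integrand is. -/
theorem differentiableOn_intervalIntegral {φ : ℂ → ℝ → ℂ} {U : Set ℂ} (hU : IsOpen U)
    (h1 : ∀ t ∈ Icc (0 : ℝ) 1, DifferentiableOn ℂ (fun z => φ z t) U)
    (h2 : ∀ z ∈ U, ContinuousOn (φ z) (Icc 0 1))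
    (h3 : ∀ z ∈ U, ∃ r > 0, ∃ B, ∀ w ∈ ball z r, ∀ t ∈ Icc (0 : ℝ) 1, ‖φ w t‖ ≤ B) :
    DifferentiableOn ℂ (fun z => ∫ t in (0 : ℝ)..1, φ z t) U := by
  intro z hz
  apply DifferentiableAt.differentiableWithinAt
  obtain ⟨r₁, hr₁, B, hB⟩ := h3 z hz
  obtain ⟨r₂, hr₂, hrU⟩ := Metric.isOpen_iff.1 hU z hz
  set r := min r₁ r₂ / 2 with hr
  have hmin : 0 < min r₁ r₂ := lt_min hr₁ hr₂
  have hr0 : 0 < r := half_pos hmin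
  have hsub : ∀ w ∈ ball z r, ∀ w' ∈ closedBall w (r / 2), w' ∈ ball z (min r₁ r₂) := by
    intro w hw w' hw'
    rw [mem_ball] at hw ⊢
    rw [mem_closedBall] at hw'
    have := dist_triangle w' w z
    linarith
  have hsub2 : ball z (min r₁ r₂) ⊆ U := (ball_subset_ball (min_le_right _ _)).trans hrU
  have hIoc : Set.uIoc (0 : ℝ) 1 = Ioc 0 1 := uIoc_of_le zero_le_one
  have hmeas : ∀ w ∈ U, AEStronglyMeasurable (φ w) (volume.restrict (Set.uIoc 0 1)) := fun w hw => by
    rw [hIoc]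
    exact ((h2 w hw).mono Ioc_subset_Icc_self).aestronglyMeasurable measurableSet_Ioc
  have hdiff : ∀ t ∈ Icc (0 : ℝ) 1, ∀ w ∈ ball z r, DifferentiableAt ℂ (fun z => φ z t) w :=
    fun t ht w hw => (h1 t ht).differentiableAt (hU.mem_nhds
      (hsub2 (hsub w hw w (mem_closedBall_self (half_pos hr0).le))))
  refine (intervalIntegral.hasDerivAt_integral_of_dominated_loc_of_deriv_le
    (F := φ) (F' := fun w t => deriv (fun z => φ z t) w) (s := ball z r) (ball_mem_nhds z hr0)
    (bound := fun _ => B / (r / 2)) ?_ ?_ ?_ ?_ ?_ ?_).2.differentiableAt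
  · filter_upwards [hU.mem_nhds hz] with w hw using hmeas w hw
  · apply ContinuousOn.intervalIntegrable
    rw [uIcc_of_le zero_le_one]
    exact h2 z hz
  · let s : ℕ → ℂ := fun n => ((r / (n + 2) : ℝ) : ℂ)
    have hs0 : ∀ n : ℕ, 0 < r / ((n : ℝ) + 2) := fun n => by positivity
    have hsr : ∀ n, z + s n ∈ ball z r := fun n => by
      rw [mem_ball, dist_eq_norm, add_sub_cancel_left, Complex.norm_real,
        Real.norm_of_nonneg (hs0 n).le]
      apply div_lt_self hr0
      have : (0 : ℝ) ≤ n := n.cast_nonneg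
      linarith
    have hst : Tendsto s atTop (𝓝[≠] 0) := by
      refine tendsto_nhdsWithin_iff.2 ⟨?_, Eventually.of_forall fun n => ?_⟩
      · have : Tendsto (fun n : ℕ => r / ((n : ℝ) + 2)) atTop (𝓝 0) :=
          Tendsto.div_atTop tendsto_const_nhds
            (tendsto_atTop_add_const_right _ _ tendsto_natCast_atTop_atTop)
        exact (Complex.continuous_ofReal.tendsto' 0 0 rfl).comp this
      · exact Complex.ofReal_ne_zero.2 (hs0 n).ne'
    refine aestronglyMeasurable_of_tendsto_ae atTop
      (f := fun n t => (s n)⁻¹ • (φ (z + s n) t - φ z t)) (fun n => ?_) ?_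
    · have := hmeas (z + s n) (hsub2 (hsub _ (hsr n) _ (mem_closedBall_self (by positivity))))
      exact AEStronglyMeasurable.const_smul (this.sub (hmeas z hz)) (s n)⁻¹
    · rw [hIoc]
      refine (ae_restrict_mem measurableSet_Ioc).mono fun t ht => ?_
      exact ((hdiff t (Ioc_subset_Icc_self ht) z (mem_ball_self hr0)).hasDerivAt.tendsto_slope_zero).comp hst
  · refine Eventually.of_forall fun t ht w hw => ?_
    rw [hIoc] at ht
    have ht' := Ioc_subset_Icc_self ht
    refine Complex.norm_deriv_le_of_forall_mem_sphere_norm_le (by positivity) ?_ ?_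
    · refine DifferentiableOn.diffContOnCl_ball (U := U) (h1 t ht') fun w' hw' => hsub2 (hsub w hw w' hw')
    · intro w' hw'
      exact hB w' (ball_subset_ball (min_le_left _ _) (hsub w hw w' (sphere_subset_closedBall hw'))) t ht'
  · exact intervalIntegrable_const
  · refine Eventually.of_forall fun t ht w hw => ?_
    rw [hIoc] at ht
    exact (hdiff t (Ioc_subset_Icc_self ht) w hw).hasDerivAt

end

section

open Metric MeasureTheory

theorem continuousOn_div_sub {γ ψ : ℝ → ℂ} (hγ : ContinuousOn γ (Icc 0 1))
    (hψ : ContinuousOn ψ (Icc 0 1)) {z : ℂ} (hz : z ∉ γ '' Icc 0 1) :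
    ContinuousOn (fun t => ψ t / (γ t - z)) (Icc 0 1) :=
  hψ.div (hγ.sub continuousOn_const) fun t ht h => hz ⟨t, ht, sub_eq_zero.1 h⟩

theorem differentiableOn_cauchyIntegral {γ ψ : ℝ → ℂ} (hγ : ContinuousOn γ (Icc 0 1))
    (hψ : ContinuousOn ψ (Icc 0 1)) :
    DifferentiableOn ℂ (fun z => ∫ t in (0 : ℝ)..1, ψ t / (γ t - z)) (γ '' Icc 0 1)ᶜ := by
  have hS : IsCompact (γ '' Icc 0 1) := isCompact_Icc.image_of_continuousOn hγ
  refine differentiableOn_intervalIntegral hS.isClosed.isOpen_compl ?_ ?_ ?_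
  · intro t ht
    refine DifferentiableOn.div (by fun_prop) (by fun_prop) fun z hz h => hz ⟨t, ht, sub_eq_zero.1 h⟩
  · intro z hz
    exact continuousOn_div_sub hγ hψ hz
  · intro z hz
    obtain ⟨δ, hδ, hδS⟩ := Metric.isOpen_iff.1 hS.isClosed.isOpen_compl z hz
    obtain ⟨B, hB⟩ := isCompact_Icc.exists_bound_of_continuousOn hψ
    refine ⟨δ / 2, half_pos hδ, B / (δ / 2), fun w hw t ht => ?_⟩
    rw [norm_div]
    have h1 : δ ≤ dist (γ t) z := by
      by_contra! h
      exact hδS (mem_ball.2 h) ⟨t, ht, rfl⟩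
    have h2 := dist_triangle (γ t) w z
    rw [mem_ball] at hw
    have h3 : δ / 2 ≤ ‖γ t - w‖ := by rw [← dist_eq_norm]; linarith
    exact div_le_div₀ ((norm_nonneg _).trans (hB t ht)) (hB t ht) (half_pos hδ) h3

theorem tendsto_cauchyIntegral {γ ψ : ℝ → ℂ} (hγ : ContinuousOn γ (Icc 0 1))
    (hψ : ContinuousOn ψ (Icc 0 1)) :
    Tendsto (fun z => ∫ t in (0 : ℝ)..1, ψ t / (γ t - z)) (cocompact ℂ) (𝓝 0) := by
  obtain ⟨B, hB⟩ := isCompact_Icc.exists_bound_of_continuousOn hψ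
  obtain ⟨R, hR⟩ := isCompact_Icc.exists_bound_of_continuousOn hγ
  have h1 : Tendsto (fun z : ℂ => B / (‖z‖ - R)) (cocompact ℂ) (𝓝 0) :=
    Tendsto.div_atTop tendsto_const_nhds
      (tendsto_atTop_add_const_right _ (-R) (tendsto_norm_cocompact_atTop (E := ℂ)))
  refine squeeze_zero_norm' ?_ h1
  filter_upwards [(tendsto_norm_cocompact_atTop (E := ℂ)).eventually_gt_atTop R] with z hz
  have := intervalIntegral.norm_integral_le_of_norm_le_const (a := (0 : ℝ)) (b := 1)
    (f := fun t => ψ t / (γ t - z)) (C := B / (‖z‖ - R)) fun t ht => by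
      rw [uIoc_of_le zero_le_one] at ht
      have ht' := Ioc_subset_Icc_self ht
      rw [norm_div]
      have h3 : ‖z‖ - R ≤ ‖γ t - z‖ := by
        have := norm_sub_norm_le z (γ t)
        have := hR t ht'
        rw [norm_sub_rev]; linarith
      exact div_le_div₀ ((norm_nonneg _).trans (hB t ht')) (hB t ht') (by linarith) h3
  simpa using this

/-- The index of a closed curve is an integer. -/
theorem exp_integral_inv_sub_eq_one {γ γ' : ℝ → ℂ}
    (hγ : ∀ t ∈ Icc (0 : ℝ) 1, HasDerivAt γ (γ' t) t) (hγ' : ContinuousOn γ' (Icc 0 1))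
    (hcl : γ 0 = γ 1) {a : ℂ} (ha : a ∉ γ '' Icc 0 1) :
    Complex.exp (∫ t in (0 : ℝ)..1, γ' t / (γ t - a)) = 1 := by
  have hγc : ContinuousOn γ (Icc 0 1) := fun t ht => (hγ t ht).continuousAt.continuousWithinAt
  have hk0 := continuousOn_div_sub hγc hγ' ha
  set k : ℝ → ℂ := IccExtend zero_le_one ((Icc (0 : ℝ) 1).domRestrict fun t => γ' t / (γ t - a))
  have hk : Continuous k := (continuousOn_iff_continuous_domRestrict.1 hk0).Icc_extend'
  have hkeq : ∀ t ∈ Icc (0 : ℝ) 1, k t = γ' t / (γ t - a) := fun t ht =>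
    IccExtend_of_mem _ _ ht
  have hφ : ∀ t, HasDerivAt (fun s => ∫ u in (0 : ℝ)..s, k u) (k t) t := fun t =>
    intervalIntegral.integral_hasDerivAt_right (hk.intervalIntegrable _ _)
      (hk.stronglyMeasurableAtFilter _ _) hk.continuousAt
  set φ : ℝ → ℂ := fun s => ∫ u in (0 : ℝ)..s, k u
  have hg : ∀ t ∈ Icc (0 : ℝ) 1, HasDerivAt (fun t => (γ t - a) * Complex.exp (-φ t)) 0 t := by
    intro t ht
    refine (((hγ t ht).sub_const a).mul (hφ t).neg.cexp).congr_deriv ?_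
    have : γ t - a ≠ 0 := fun h => ha ⟨t, ht, sub_eq_zero.1 h⟩
    rw [hkeq t ht]
    field_simp
    ring
  have hconst := constant_of_has_deriv_right_zero
    (fun t ht => (hg t ht).continuousAt.continuousWithinAt)
    (fun t ht => (hg t (Ico_subset_Icc_self ht)).hasDerivWithinAt) 1 (right_mem_Icc.2 zero_le_one)
  have h0 : φ 0 = 0 := intervalIntegral.integral_same
  have h1 : φ 1 = ∫ t in (0 : ℝ)..1, γ' t / (γ t - a) :=
    intervalIntegral.integral_congr fun t ht => hkeq t (by rwa [uIcc_of_le zero_le_one] at ht)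
  have hne : γ 1 - a ≠ 0 := fun h => ha ⟨1, right_mem_Icc.2 zero_le_one, sub_eq_zero.1 h⟩
  simp only [h0, hcl, neg_zero, Complex.exp_zero] at hconst
  have h2 : Complex.exp (-φ 1) = 1 := mul_left_cancel₀ hne hconst
  rw [Complex.exp_neg, inv_eq_one] at h2
  rw [← h1, h2]

theorem eq_zero_of_exp_eq_one {z : ℂ} (h : Complex.exp z = 1) (hz : ‖z‖ ≤ 1) : z = 0 := by
  obtain ⟨n, rfl⟩ := Complex.exp_eq_one_iff.1 h
  rw [norm_mul, norm_mul, norm_mul] at hz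
  simp only [Complex.norm_intCast, Complex.norm_real, Complex.norm_I, mul_one, Complex.norm_ofNat,
    Real.norm_eq_abs, abs_of_pos Real.pi_pos] at hz
  have h1 : |(n : ℝ)| < 1 := by
    by_contra! h1
    have := Real.pi_gt_three
    nlinarith
  have h2 : |n| < 1 := by exact_mod_cast h1
  simp [Int.abs_lt_one_iff.1 h2]

theorem continuousOn_dslope_comp {U : Set ℂ} (hU : IsOpen U) {F : ℂ → ℂ}
    (hF : DifferentiableOn ℂ F U) {γ : ℝ → ℂ} {s : Set ℝ} (hγ : ContinuousOn γ s)
    (hγU : ∀ t ∈ s, γ t ∈ U) {z : ℂ} (hz : z ∈ U) :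
    ContinuousOn (fun t => dslope F (γ t) z) s := by
  have h1 : ContinuousOn (dslope F z) U :=
    ((Complex.differentiableOn_dslope (hU.mem_nhds hz)).2 hF).continuousOn
  have h2 : ContinuousOn (fun t => dslope F z (γ t)) s := h1.comp hγ hγU
  refine h2.congr fun t _ => ?_
  exact dslope_comm _ _ _

/-- Cauchy's theorem for closed curves in the complement of a closed connected set that contains
a neighbourhood of infinity. -/
theorem integral_eq_zero_of_isPreconnected_compl {C : Set ℂ} (hC : IsClosed C)
    (hCc : IsPreconnected C) {M : ℝ} (hM : ∀ z : ℂ, M ≤ ‖z‖ → z ∈ C) {f : ℂ → ℂ}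
    (hf : DifferentiableOn ℂ f Cᶜ) {γ γ' : ℝ → ℂ}
    (hγ : ∀ t ∈ Icc (0 : ℝ) 1, HasDerivAt γ (γ' t) t) (hγ' : ContinuousOn γ' (Icc 0 1))
    (hcl : γ 0 = γ 1) (hγC : ∀ t ∈ Icc (0 : ℝ) 1, γ t ∉ C) :
    ∫ t in (0 : ℝ)..1, f (γ t) * γ' t = 0 := by
  have hγc : ContinuousOn γ (Icc 0 1) := fun t ht => (hγ t ht).continuousAt.continuousWithinAt
  set S := γ '' Icc 0 1 with hSdef
  have hS : IsCompact S := isCompact_Icc.image_of_continuousOn hγc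
  have hSC : S ⊆ Cᶜ := by rintro _ ⟨t, ht, rfl⟩; exact hγC t ht
  have hU : IsOpen Cᶜ := hC.isOpen_compl
  set ind : ℂ → ℂ := fun z => ∫ t in (0 : ℝ)..1, γ' t / (γ t - z) with hind
  have hindc : ContinuousOn ind Sᶜ := (differentiableOn_cauchyIntegral hγc hγ').continuousOn
  have hind1 : ∀ z ∉ S, ‖ind z‖ ≤ 1 → ind z = 0 := fun z hz h =>
    eq_zero_of_exp_eq_one (exp_integral_inv_sub_eq_one hγ hγ' hcl hz) h
  have hlim : Tendsto (fun z => ‖ind z‖) (cocompact ℂ) (𝓝 0) := by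
    simpa using (tendsto_cauchyIntegral hγc hγ').norm
  have hlarge : ∀ᶠ z in cocompact ℂ, z ∈ C :=
    ((tendsto_norm_cocompact_atTop (E := ℂ)).eventually_ge_atTop M).mono hM
  set Ω : Set ℂ := Sᶜ ∩ (fun z => ‖ind z‖) ⁻¹' Iio 1 with hΩdef
  have hΩ : IsOpen Ω := hindc.norm.isOpen_inter_preimage hS.isClosed.isOpen_compl isOpen_Iio
  have hCS : C ⊆ Sᶜ := subset_compl_comm.1 hSC
  have hCΩ : C ⊆ Ω := by
    intro z hz
    refine ⟨hCS hz, ?_⟩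
    by_contra h
    rw [mem_preimage, mem_Iio, not_lt] at h
    obtain ⟨w, hw1, hw2⟩ := ((hlim.eventually_lt_const zero_lt_one).and hlarge).exists
    have hp : IsPreconnected ((fun z => ‖ind z‖) '' C) := hCc.image _ (hindc.mono hCS).norm
    obtain ⟨v, hv, hv1⟩ := hp.ordConnected.out ⟨w, hw2, rfl⟩ ⟨z, hz, rfl⟩
      (show (1 : ℝ) ∈ Icc _ _ from ⟨hw1.le, h⟩)
    have := hind1 v (hCS hv) hv1.le
    simp [this] at hv1
  obtain ⟨z₀, hz₀⟩ := hlarge.exists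
  set F : ℂ → ℂ := fun w => (w - z₀) * f w with hFdef
  have hF : DifferentiableOn ℂ F Cᶜ := by
    refine DifferentiableOn.mul (by fun_prop) hf
  have hFγ : ContinuousOn (fun t => F (γ t)) (Icc 0 1) := hF.continuousOn.comp hγc hγC
  have hψ : ContinuousOn (fun t => F (γ t) * γ' t) (Icc 0 1) := hFγ.mul hγ'
  have hdd := continuousOn_dslope_uncurry hU hF
  classical
  set h : ℂ → ℂ := fun z => if z ∈ Cᶜ then ∫ t in (0 : ℝ)..1, dslope F (γ t) z * γ' t
    else ∫ t in (0 : ℝ)..1, F (γ t) * γ' t / (γ t - z) with hhdef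
  have hhΩ : ∀ z ∈ Ω, h z = ∫ t in (0 : ℝ)..1, F (γ t) * γ' t / (γ t - z) := by
    intro z hz
    by_cases hzC : z ∈ Cᶜ
    · have h1 : h z = ∫ t in (0 : ℝ)..1, dslope F (γ t) z * γ' t := if_pos hzC
      have h2 : ∀ t ∈ uIcc (0 : ℝ) 1, dslope F (γ t) z * γ' t =
          F (γ t) * γ' t / (γ t - z) - F z * (γ' t / (γ t - z)) := by
        intro t ht
        rw [uIcc_of_le zero_le_one] at ht
        have hne : γ t ≠ z := fun e => hz.1 ⟨t, ht, e⟩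
        have hne' : γ t - z ≠ 0 := sub_ne_zero.2 hne
        rw [dslope_comm, dslope_of_ne _ hne, slope_def_field]
        field_simp
      have hI1 : IntervalIntegrable (fun t => F (γ t) * γ' t / (γ t - z)) volume 0 1 := by
        apply ContinuousOn.intervalIntegrable
        rw [uIcc_of_le zero_le_one]
        exact continuousOn_div_sub hγc hψ hz.1
      have hI2 : IntervalIntegrable (fun t => γ' t / (γ t - z)) volume 0 1 := by
        apply ContinuousOn.intervalIntegrable
        rw [uIcc_of_le zero_le_one]
        exact continuousOn_div_sub hγc hγ' hz.1
      rw [h1, intervalIntegral.integral_congr h2, intervalIntegral.integral_sub hI1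
        (hI2.const_mul _), intervalIntegral.integral_const_mul]
      have h3 : ind z = 0 := hind1 z hz.1 (le_of_lt hz.2)
      change _ - F z * ind z = _
      rw [h3, mul_zero, sub_zero]
    · exact if_neg hzC
  have hd1 : DifferentiableOn ℂ h Cᶜ := by
    refine DifferentiableOn.congr (f := fun z => ∫ t in (0 : ℝ)..1, dslope F (γ t) z * γ' t) ?_
      fun z hz => if_pos hz
    refine differentiableOn_intervalIntegral (φ := fun z t => dslope F (γ t) z * γ' t) hU ?_ ?_ ?_
    · intro t ht
      refine DifferentiableOn.mul ?_ (by fun_prop)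
      exact (Complex.differentiableOn_dslope (hU.mem_nhds (hγC t ht))).2 hF
    · intro z hz
      exact (continuousOn_dslope_comp hU hF hγc hγC hz).mul hγ'
    · intro z hz
      obtain ⟨r, hr, hrU⟩ := nhds_basis_closedBall.mem_iff.1 (hU.mem_nhds hz)
      have hdd' := hdd.mono (prod_mono hSC hrU)
      obtain ⟨B, hB⟩ : ∃ B, ∀ p ∈ S ×ˢ closedBall z r, ‖dslope F p.1 p.2‖ ≤ B :=
        (hS.prod (isCompact_closedBall z r)).exists_bound_of_continuousOn hdd'
      obtain ⟨B', hB'⟩ := isCompact_Icc.exists_bound_of_continuousOn hγ'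
      refine ⟨r, hr, B * B', fun w hw t ht => ?_⟩
      have h1 := hB (γ t, w) ⟨⟨t, ht, rfl⟩, ball_subset_closedBall hw⟩
      rw [norm_mul]
      exact mul_le_mul h1 (hB' t ht) (norm_nonneg _) ((norm_nonneg _).trans h1)
  have hd2 : DifferentiableOn ℂ h Ω :=
    ((differentiableOn_cauchyIntegral hγc hψ).mono inter_subset_left).congr hhΩ
  have hd : Differentiable ℂ h := by
    intro z
    by_cases hz : z ∈ Cᶜ
    · exact hd1.differentiableAt (hU.mem_nhds hz)
    · exact hd2.differentiableAt (hΩ.mem_nhds (hCΩ (not_not.1 hz)))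
  have hh0 : Tendsto h (cocompact ℂ) (𝓝 0) := by
    refine (tendsto_cauchyIntegral hγc hψ).congr' ?_
    filter_upwards [hlarge] with z hz
    exact (hhΩ z (hCΩ hz)).symm
  have hz0 := hd.apply_eq_of_tendsto_cocompact z₀ hh0
  rw [hhΩ z₀ (hCΩ hz₀)] at hz0
  rw [← hz0]
  refine intervalIntegral.integral_congr fun t ht => ?_
  rw [uIcc_of_le zero_le_one] at ht
  have : γ t - z₀ ≠ 0 := sub_ne_zero.2 fun e => hγC t ht (e ▸ hz₀)
  simp only [hFdef]
  field_simp

end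

section

open Metric MeasureTheory
open scoped unitInterval

/-- Holomorphic nowhere vanishing functions on a component of the complement of a closed connected
set that contains a neighbourhood of infinity have continuous logarithms. -/
theorem exists_continuousOn_log_component {C : Set ℂ} (hC : IsClosed C)
    (hCc : IsPreconnected C) {M : ℝ} (hM : ∀ z : ℂ, M ≤ ‖z‖ → z ∈ C) {x₀ : ℂ} (hx₀ : x₀ ∈ Cᶜ)
    {g : ℂ → ℂ} (hg : DifferentiableOn ℂ g (connectedComponentIn Cᶜ x₀))
    (hg0 : ∀ z ∈ connectedComponentIn Cᶜ x₀, g z ≠ 0) :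
    ∃ h : ℂ → ℂ, ContinuousOn h (connectedComponentIn Cᶜ x₀) ∧
      ∀ z ∈ connectedComponentIn Cᶜ x₀, Complex.exp (h z) = g z := by
  have hU : IsOpen Cᶜ := hC.isOpen_compl
  set N := connectedComponentIn Cᶜ x₀ with hN
  have hNo : IsOpen N := hU.connectedComponentIn
  have hNC : N ⊆ Cᶜ := connectedComponentIn_subset _ _
  have hxN : x₀ ∈ N := mem_connectedComponentIn hx₀
  have hNconn : IsConnected N := isConnected_connectedComponentIn_iff.2 hx₀
  have hNp : IsPathConnected N := hNo.isConnected_iff_isPathConnected.1 hNconn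
  have hB : ∀ z ∈ N, ‖z‖ ≤ M := fun z hz => by
    by_contra! h
    exact hNC hz (hM z h.le)
  obtain ⟨q, hq, hq', hqN, ⟨e₀, he₀, hqe₀⟩, hlift⟩ := exists_holomorphic_covering hNo hB hxN
  have hsurj : ∀ z ∈ N, ∃ e ∈ ball (0 : ℂ) 1, q e = z := by
    intro z hz
    obtain ⟨Γ, hΓ⟩ := hNp.joinedIn x₀ hxN z hz
    obtain ⟨L, -, hL⟩ := hlift ⟨e₀, he₀⟩ (Γ : C(I, ℂ)) hΓ (by simp [hqe₀])
    exact ⟨L 1, (L 1).2, by simpa using hL 1⟩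
  classical
  set f : ℂ → ℂ := fun z => if z ∈ N then deriv g z / g z else 0 with hf
  have hfd : DifferentiableOn ℂ f Cᶜ := by
    intro z hz
    apply DifferentiableAt.differentiableWithinAt
    by_cases hzN : z ∈ N
    · have h1 : DifferentiableAt ℂ (fun z => deriv g z / g z) z :=
        ((hg.deriv hNo).differentiableAt (hNo.mem_nhds hzN)).div
          (hg.differentiableAt (hNo.mem_nhds hzN)) (hg0 z hzN)
      refine h1.congr_of_eventuallyEq ?_
      filter_upwards [hNo.mem_nhds hzN] with w hw
      exact if_pos hw
    · refine (differentiableAt_const (0 : ℂ)).congr_of_eventuallyEq ?_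
      filter_upwards [hU.connectedComponentIn.mem_nhds (mem_connectedComponentIn hz)] with w hw
      refine if_neg fun hwN => hzN ?_
      rw [hN, connectedComponentIn_eq hwN, ← connectedComponentIn_eq hw]
      exact mem_connectedComponentIn hz
  have hbo : IsOpen (ball (0 : ℂ) 1) := isOpen_ball
  have hqd : ∀ z ∈ ball (0 : ℂ) 1, HasDerivAt q (deriv q z) z := fun z hz =>
    (hq.differentiableAt (hbo.mem_nhds hz)).hasDerivAt
  have hfq : DifferentiableOn ℂ (fun z => f (q z) * deriv q z) (ball 0 1) :=
    (hfd.comp hq fun z hz => hNC (hqN z hz)).mul (hq.deriv hbo)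
  obtain ⟨H, hH⟩ := hfq.isExactOn_ball
  have hdesc : ∀ e ∈ ball (0 : ℂ) 1, ∀ e' ∈ ball (0 : ℂ) 1, q e = q e' → H e = H e' := by
    intro e he e' he' hee
    have hseg : ∀ t ∈ Icc (0 : ℝ) 1, e + t * (e' - e) ∈ ball (0 : ℂ) 1 := by
      intro t ht
      have := (convex_ball (0 : ℂ) 1).add_smul_sub_mem he he' ht
      simpa using this
    have hline : ∀ t : ℝ, HasDerivAt (fun t : ℝ => e + t * (e' - e)) (e' - e) t := by
      intro t
      have h1 : HasDerivAt (fun t : ℝ => (t : ℂ)) 1 t := Complex.ofRealCLM.hasDerivAt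
      simpa using (h1.mul_const (e' - e)).const_add e
    have h1 : ∀ t ∈ Icc (0 : ℝ) 1, HasDerivAt (fun t : ℝ => q (e + t * (e' - e)))
        (deriv q (e + t * (e' - e)) * (e' - e)) t := fun t ht =>
      (hqd _ (hseg t ht)).comp_of_eq t (hline t) rfl
    have hlc : ContinuousOn (fun t : ℝ => e + t * (e' - e)) (Icc 0 1) :=
      fun t _ => (hline t).continuousAt.continuousWithinAt
    have h2 := integral_eq_zero_of_isPreconnected_compl hC hCc hM hfd h1
      (((hq.deriv hbo).continuousOn.comp hlc hseg).mul continuousOn_const) (by simpa using hee)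
      (fun t ht => hNC (hqN _ (hseg t ht)))
    have h3 : ∀ t ∈ uIcc (0 : ℝ) 1, HasDerivAt (fun t : ℝ => H (e + t * (e' - e)))
        (f (q (e + t * (e' - e))) * (deriv q (e + t * (e' - e)) * (e' - e))) t := by
      intro t ht
      rw [uIcc_of_le zero_le_one] at ht
      have := (hH _ (hseg t ht)).comp_of_eq t (hline t) rfl
      exact this.congr_deriv (by ring)
    have h4 := intervalIntegral.integral_eq_sub_of_hasDerivAt h3 (by
      apply ContinuousOn.intervalIntegrable
      rw [uIcc_of_le zero_le_one]
      have := (hfq.continuousOn.comp hlc hseg).mul (continuousOn_const (c := e' - e))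
      refine this.congr fun t _ => ?_
      simp [mul_assoc])
    rw [h2] at h4
    have : H e' - H e = 0 := by simpa using h4.symm
    exact (sub_eq_zero.1 this).symm
  choose! s hs1 hs2 using hsurj
  have hHs : ∀ e ∈ ball (0 : ℂ) 1, H (s (q e)) = H e := fun e he =>
    hdesc _ (hs1 _ (hqN e he)) _ he (hs2 _ (hqN e he))
  obtain ⟨c, hc⟩ : ∃ c, ∀ e ∈ ball (0 : ℂ) 1, g (q e) * Complex.exp (-H e) = c := by
    have hd : ∀ e ∈ ball (0 : ℂ) 1,
        HasDerivAt (fun e => g (q e) * Complex.exp (-H e)) 0 e := by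
      intro e he
      have h1 : HasDerivAt g (deriv g (q e)) (q e) :=
        (hg.differentiableAt (hNo.mem_nhds (hqN e he))).hasDerivAt
      have h2 := (h1.comp e (hqd e he)).mul (hH e he).neg.cexp
      refine h2.congr_deriv ?_
      have h3 : f (q e) = deriv g (q e) / g (q e) := if_pos (hqN e he)
      have h4 := hg0 _ (hqN e he)
      simp only [h3, Function.comp_apply]
      field_simp
      ring
    refine hbo.exists_is_const_of_deriv_eq_zero (convex_ball (0 : ℂ) 1).isPreconnected
      (fun e he => (hd e he).differentiableAt.differentiableWithinAt) fun e he => (hd e he).deriv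
  have hc0 : c ≠ 0 := by
    rw [← hc e₀ he₀]
    exact mul_ne_zero (hg0 _ (hqN _ he₀)) (Complex.exp_ne_zero _)
  refine ⟨fun z => H (s z) + Complex.log c, ?_, ?_⟩
  · refine ContinuousOn.add ?_ continuousOn_const
    intro z hz
    apply ContinuousAt.continuousWithinAt
    have hz' := hs2 z hz
    have hmap := (isLocalHomeomorph_of_deriv_ne_zero hq hq').map_nhds_eq ⟨s z, hs1 z hz⟩
    simp only [hz'] at hmap
    rw [ContinuousAt, ← hmap, tendsto_map'_iff]
    have h1 : Tendsto (fun e : ball (0 : ℂ) 1 => H e) (𝓝 ⟨s z, hs1 z hz⟩) (𝓝 (H (s z))) :=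
      ((hH _ (hs1 z hz)).continuousAt.tendsto.comp continuousAt_subtype_val.tendsto)
    exact h1.congr fun e => (hHs e e.2).symm
  · intro z hz
    have h1 := hc (s z) (hs1 z hz)
    rw [hs2 z hz] at h1
    rw [Complex.exp_add, Complex.exp_log hc0, ← h1, mul_comm, mul_assoc, ← Complex.exp_add]
    simp

end

section

open Metric

/-- An open subset of the plane, spread over the plane by the inclusion. -/
theorem exists_planeSpread_coe {N : Set ℂ} (hN : IsOpen N) :
    ∃ P : PlaneSpread N, (∀ x, P.p x = x) ∧
      ∀ x : N, ∀ w ∈ ball (x : ℂ) (P.ε x), ∃ h : w ∈ N, P.c x w = ⟨w, h⟩ := by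
  classical
  have hε : ∀ x : N, ∃ ε > 0, ball (x : ℂ) ε ⊆ N := fun x => Metric.isOpen_iff.1 hN x x.2
  choose ε hε0 hεN using hε
  have hc : ∀ x : N, ∀ w ∈ ball (x : ℂ) (ε x),
      ((if h : w ∈ N then (⟨w, h⟩ : N) else x : N) : ℂ) = w := fun x w hw => by
    rw [dif_pos (hεN x hw)]
  refine ⟨{ p := fun x => x
            c := fun x w => if h : w ∈ N then ⟨w, h⟩ else x
            ε := ε
            U := fun x => {y | (y : ℂ) ∈ ball (x : ℂ) (ε x)}
            p_cont := continuous_subtype_val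
            ε_pos := hε0
            U_nhds := fun x => (isOpen_ball.preimage continuous_subtype_val).mem_nhds
              (mem_ball_self (hε0 x))
            c_cont := fun x => ?_
            c_self := fun x => Subtype.ext (hc x x (mem_ball_self (hε0 x)))
            c_mem := fun x w hw => ?_
            p_c := hc
            p_U := fun x y hy => hy
            fiber := fun x w => ?_ }, fun x => rfl, fun x w hw => ⟨hεN x hw, dif_pos _⟩⟩
  · rw [Topology.IsInducing.subtypeVal.continuousOn_iff]
    exact continuousOn_id.congr fun w hw => hc x w hw
  · change ((if h : w ∈ N then (⟨w, h⟩ : N) else x : N) : ℂ) ∈ ball (x : ℂ) (ε x)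
    rw [hc x w hw]
    exact hw
  · apply Set.Subsingleton.isPreconnected
    intro y hy z hz
    exact Subtype.ext (hy.2.trans hz.2.symm)

/-- The Riemann mapping theorem for the components of the complement of a closed connected set
that contains a neighbourhood of infinity. -/
theorem exists_riemann_map {C : Set ℂ} (hC : IsClosed C)
    (hCc : IsPreconnected C) {M : ℝ} (hM : ∀ z : ℂ, M ≤ ‖z‖ → z ∈ C) {x₀ : ℂ} (hx₀ : x₀ ∈ Cᶜ) :
    ∃ r : ℂ → ℂ, DifferentiableOn ℂ r (ball 0 1) ∧ (∀ z ∈ ball (0 : ℂ) 1, deriv r z ≠ 0) ∧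
      InjOn r (ball 0 1) ∧ r '' ball 0 1 = connectedComponentIn Cᶜ x₀ := by
  have hNo : IsOpen (connectedComponentIn Cᶜ x₀) := hC.isOpen_compl.connectedComponentIn
  have hlog := fun g hg hg0 => exists_continuousOn_log_component hC hCc hM hx₀ (g := g) hg hg0
  have hNC : connectedComponentIn Cᶜ x₀ ⊆ Cᶜ := connectedComponentIn_subset _ _
  have hxN : x₀ ∈ connectedComponentIn Cᶜ x₀ := mem_connectedComponentIn hx₀
  have hNconn : IsConnected (connectedComponentIn Cᶜ x₀) :=
    isConnected_connectedComponentIn_iff.2 hx₀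
  generalize connectedComponentIn Cᶜ x₀ = N at *
  have hcs : ConnectedSpace N := isConnected_iff_connectedSpace.1 hNconn
  obtain ⟨P, hPp, hPc⟩ := exists_planeSpread_coe hNo
  obtain ⟨f, hf, hf1, hfs, hfp⟩ := P.exists_uniformization ⟨x₀, hxN⟩ (B := M) (fun x => by
    rw [hPp]
    by_contra! h
    exact hNC x.2 (hM _ h.le)) (fun g hg hg0 => by
      classical
      obtain ⟨h, hhc, hh⟩ := hlog (fun w => if h : w ∈ N then g ⟨w, h⟩ else 0) (fun w hw => by
        apply DifferentiableAt.differentiableWithinAt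
        have h1 := (hg ⟨w, hw⟩).1
        rw [hPp] at h1
        have hb : ball w (P.ε ⟨w, hw⟩) ∈ 𝓝 w := ball_mem_nhds _ (P.ε_pos _)
        refine (h1.differentiableAt hb).congr_of_eventuallyEq ?_
        filter_upwards [hb] with v hv
        obtain ⟨hvN, hv'⟩ := hPc ⟨w, hw⟩ v hv
        rw [dif_pos hvN, Function.comp_apply, hv']) (fun w hw => by
          rw [dif_pos hw]
          exact hg0 _)
      refine ⟨fun x => Complex.exp (h x / 2), ?_, fun x => ?_⟩
      · exact Complex.continuous_exp.comp
          ((hhc.comp_continuous continuous_subtype_val (fun x : N => x.2)).div_const 2)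
      · rw [← Complex.exp_nat_mul]
        have h2 := hh x x.2
        rw [dif_pos x.2] at h2
        rw [← h2]
        congr 1
        push_cast
        ring)
  obtain ⟨q, hq, hqd, hqf⟩ := PlaneSpread.exists_locally_univalent hf hfs hfp
  refine ⟨q, hq, hqd, ?_, ?_⟩
  · intro z hz w hw hzw
    obtain ⟨x, rfl⟩ := hfs z (by simpa using hz)
    obtain ⟨y, rfl⟩ := hfs w (by simpa using hw)
    rw [hqf, hqf, hPp, hPp] at hzw
    rw [Subtype.ext hzw]
  · ext w
    constructor
    · rintro ⟨z, hz, rfl⟩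
      obtain ⟨x, rfl⟩ := hfs z (by simpa using hz)
      rw [hqf, hPp]
      exact x.2
    · intro hw
      exact ⟨f ⟨w, hw⟩, by simpa using hf1 _, by rw [hqf, hPp]⟩

end

section

open Metric

/-- Every nowhere vanishing continuous function on `K` has a continuous logarithm. -/
def HasContinuousLogs (K : Set ℂ) : Prop :=
  ∀ g : ℂ → ℂ, ContinuousOn g K → (∀ z ∈ K, g z ≠ 0) →
    ∃ h : ℂ → ℂ, ContinuousOn h K ∧ ∀ z ∈ K, Complex.exp (h z) = g z

theorem IsPreconnected.eq_of_exp_eq_one {X : Type*} [TopologicalSpace X] {s : Set X}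
    (hs : IsPreconnected s) {u : X → ℂ} (hu : ContinuousOn u s)
    (h : ∀ x ∈ s, Complex.exp (u x) = 1) {x y : X} (hx : x ∈ s) (hy : y ∈ s) : u x = u y := by
  have key : ∀ w ∈ s, ‖u w - u y‖ ≤ 1 → u w = u y := fun w hw hwy =>
    sub_eq_zero.1 (eq_zero_of_exp_eq_one (by rw [Complex.exp_sub, h w hw, h y hy, div_one]) hwy)
  by_cases hxy : ‖u x - u y‖ ≤ 1
  · exact key x hx hxy
  · push Not at hxy
    have hp : IsPreconnected ((fun w => ‖u w - u y‖) '' s) :=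
      hs.image _ (hu.sub continuousOn_const).norm
    obtain ⟨v, hv, hv1⟩ := hp.ordConnected.out ⟨y, hy, rfl⟩ ⟨x, hx, rfl⟩
      (show (1 : ℝ) ∈ Icc _ _ from ⟨by simp, hxy.le⟩)
    have h1 := key v hv (by simpa using hv1.le)
    simp [h1] at hv1

/-- The radial retraction onto the closed unit ball. -/
theorem exists_retraction_closedBall {E : Type*} [NormedAddCommGroup E] [NormedSpace ℝ E] :
    ∃ ρ : E → closedBall (0 : E) 1, Continuous ρ ∧ ∀ x : closedBall (0 : E) 1, ρ x = x := by
  have hpos : ∀ x : E, 0 < max 1 ‖x‖ := fun x => lt_max_of_lt_left one_pos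
  refine ⟨fun x => ⟨(max 1 ‖x‖)⁻¹ • x, ?_⟩, ?_, fun x => Subtype.ext ?_⟩
  · rw [mem_closedBall_zero_iff, norm_smul, norm_inv, Real.norm_of_nonneg (hpos x).le,
      inv_mul_le_iff₀ (hpos x), mul_one]
    exact le_max_right _ _
  · refine Continuous.subtype_mk (Continuous.smul (Continuous.inv₀ (by fun_prop) fun x => ?_)
      continuous_id) _
    exact (hpos x).ne'
  · have := mem_closedBall_zero_iff.1 x.2
    simp [max_eq_left this]

theorem hasContinuousLogs_of_homeomorph {E : Type*} [NormedAddCommGroup E] [NormedSpace ℝ E]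
    {D : Set ℂ} (e : D ≃ₜ closedBall (0 : E) 1) : HasContinuousLogs D := by
  intro g hg hg0
  obtain ⟨ρ, hρ, hρi⟩ := exists_retraction_closedBall (E := E)
  have hc : Continuous fun x : E => g (e.symm (ρ x)) :=
    hg.comp_continuous (continuous_subtype_val.comp (e.symm.continuous.comp hρ))
      fun x => (e.symm (ρ x)).2
  obtain ⟨h, hh, hhe⟩ := exists_continuous_log hc fun x => hg0 _ (e.symm (ρ x)).2
  classical
  refine ⟨fun z => if hz : z ∈ D then h (e ⟨z, hz⟩) else 0, ?_, fun z hz => ?_⟩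
  · rw [continuousOn_iff_continuous_domRestrict]
    have : Continuous fun z : D => h (e z) := hh.comp (continuous_subtype_val.comp e.continuous)
    refine this.congr fun z => ?_
    simp [Set.domRestrict_apply]
  · simp only [dif_pos hz]
    rw [hhe, hρi, e.symm_apply_apply]

theorem HasContinuousLogs.union {D E : Set ℂ} (hD : HasContinuousLogs D)
    (hE : HasContinuousLogs E) (hDc : IsClosed D) (hEc : IsClosed E)
    (hDE : IsConnected (D ∩ E)) : HasContinuousLogs (D ∪ E) := by
  intro g hg hg0
  obtain ⟨h₁, hc₁, he₁⟩ := hD g (hg.mono subset_union_left) fun z hz => hg0 z (.inl hz)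
  obtain ⟨h₂, hc₂, he₂⟩ := hE g (hg.mono subset_union_right) fun z hz => hg0 z (.inr hz)
  obtain ⟨a, ha⟩ := hDE.nonempty
  have hconst : ∀ z ∈ D ∩ E, h₁ z - h₂ z = h₁ a - h₂ a := fun z hz =>
    hDE.isPreconnected.eq_of_exp_eq_one (u := fun z => h₁ z - h₂ z)
      ((hc₁.mono inter_subset_left).sub (hc₂.mono inter_subset_right))
      (fun w hw => by
        rw [Complex.exp_sub, he₁ w hw.1, he₂ w hw.2, div_self (hg0 w (.inl hw.1))]) hz ha
  have hone : Complex.exp (h₁ a - h₂ a) = 1 := by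
    rw [Complex.exp_sub, he₁ a ha.1, he₂ a ha.2, div_self (hg0 a (.inl ha.1))]
  classical
  have hE' : ∀ z ∈ E, (if z ∈ D then h₁ z else h₂ z + (h₁ a - h₂ a)) =
      h₂ z + (h₁ a - h₂ a) := fun z hz => by
    split_ifs with h
    · rw [← hconst z ⟨h, hz⟩]; ring
    · rfl
  refine ⟨fun z => if z ∈ D then h₁ z else h₂ z + (h₁ a - h₂ a), ?_, ?_⟩
  · exact (hc₁.congr fun z hz => if_pos hz).union_of_isClosed
      ((hc₂.add continuousOn_const).congr hE') hDc hEc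
  · rintro z (hz | hz)
    · simp only [if_pos hz, he₁ z hz]
    · simp only [hE' z hz]
      rw [Complex.exp_add, he₂ z hz, hone, mul_one]

/-- The components of the complement of a compact set with continuous logarithms are unbounded. -/
theorem HasContinuousLogs.exists_mem_connectedComponentIn {K : Set ℂ} (hK : IsClosed K)
    (hlog : HasContinuousLogs K) {p : ℂ} (hp : p ∈ Kᶜ) (M : ℝ) :
    ∃ z ∈ connectedComponentIn Kᶜ p, M ≤ ‖z - p‖ := by
  by_contra! hM
  set O := connectedComponentIn Kᶜ p with hO
  have hOo : IsOpen O := hK.isOpen_compl.connectedComponentIn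
  have hpO : p ∈ O := mem_connectedComponentIn hp
  have hfr : ∀ a ∈ frontier O, a ∈ K := by
    intro a ha
    by_contra haK
    obtain ⟨w, hw1, hw2⟩ := mem_closure_iff.1 ha.1 _ hK.isOpen_compl.connectedComponentIn
      (mem_connectedComponentIn (show a ∈ Kᶜ from haK))
    have : a ∈ O := by
      rw [hO, connectedComponentIn_eq hw2, ← connectedComponentIn_eq hw1]
      exact mem_connectedComponentIn haK
    exact ha.2 (by rwa [hOo.interior_eq])
  obtain ⟨h, hhc, hhe⟩ := hlog (fun z => z - p) (by fun_prop) fun z hz h0 =>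
    hp (by rwa [← sub_eq_zero.1 h0])
  obtain ⟨k, hk⟩ := ContinuousMap.exists_restrict_eq hK ⟨_, hhc.domRestrict⟩
  have hkK : ∀ z ∈ K, k z = h z := fun z hz => congrArg (fun φ : C(K, ℂ) => φ ⟨z, hz⟩) hk
  classical
  have hc : Continuous fun z => if z ∈ O then Complex.exp (k z) else z - p := by
    refine Continuous.if (fun a ha => ?_) (by fun_prop) (by fun_prop)
    have haK := hfr a ha
    rw [hkK a haK, hhe a haK]
  obtain ⟨H, hHc, hHe⟩ := exists_continuous_log hc fun z => by
    split_ifs with hz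
    · exact Complex.exp_ne_zero _
    · exact sub_ne_zero.2 fun e => hz (e ▸ hpO)
  have hMpos : 0 < M := by simpa using hM p hpO
  have hcirc : ∀ t : ℝ, Complex.exp (H (p + M * Complex.exp (t * Complex.I))) =
      M * Complex.exp (t * Complex.I) := by
    intro t
    rw [hHe, if_neg, add_sub_cancel_left]
    intro hmem
    have := hM _ hmem
    simp [Complex.norm_exp_ofReal_mul_I, abs_of_pos hMpos] at this
  have hMne : (M : ℂ) ≠ 0 := by exact_mod_cast hMpos.ne'
  have hu := (isPreconnected_univ (α := ℝ)).eq_of_exp_eq_one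
    (u := fun t : ℝ => H (p + M * Complex.exp (t * Complex.I)) - t * Complex.I - Complex.log M)
    (by fun_prop) (fun t _ => by
      rw [Complex.exp_sub, Complex.exp_sub, hcirc, Complex.exp_log hMne]
      field_simp) (mem_univ 0) (mem_univ (2 * Real.pi))
  have h2 : Complex.exp (((2 * Real.pi : ℝ) : ℂ) * Complex.I) = 1 := by
    push_cast
    exact Complex.exp_two_pi_mul_I
  rw [h2] at hu
  have h3 : (2 * Real.pi * Complex.I : ℂ) = 0 := by
    simp only [Complex.ofReal_zero, zero_mul, Complex.exp_zero, mul_one, sub_zero] at hu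
    push_cast at hu
    linear_combination hu
  exact Complex.two_pi_I_ne_zero h3

theorem isPreconnected_le_norm (M : ℝ) : IsPreconnected {z : ℂ | M ≤ ‖z‖} := by
  have h : {z : ℂ | M ≤ ‖z‖} = (fun p : ℝ × ℝ => (p.1 : ℂ) * Complex.exp (p.2 * Complex.I)) ''
      (Ici (max M 0) ×ˢ univ) := by
    ext z
    constructor
    · intro hz
      exact ⟨(‖z‖, z.arg), ⟨max_le hz (norm_nonneg z), mem_univ _⟩, Complex.norm_mul_exp_arg_mul_I z⟩
    · rintro ⟨⟨r, t⟩, ⟨hr, -⟩, rfl⟩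
      have h1 : M ≤ r := (le_max_left _ _).trans hr
      have h2 : 0 ≤ r := (le_max_right _ _).trans hr
      simpa [Complex.norm_exp_ofReal_mul_I, abs_of_nonneg h2] using h1
  rw [h]
  exact (((convex_Ici _).prod convex_univ).isPreconnected).image _ (by fun_prop)

theorem HasContinuousLogs.isPreconnected_compl {K : Set ℂ} (hK : IsClosed K)
    (hlog : HasContinuousLogs K) {M : ℝ} (hM : K ⊆ ball 0 M) : IsPreconnected Kᶜ := by
  have hMK : {z : ℂ | M ≤ ‖z‖} ⊆ Kᶜ := fun z hz hzK => by
    have := mem_ball_zero_iff.1 (hM hzK)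
    exact this.not_ge hz
  have hm : ((|M| : ℝ) : ℂ) ∈ {z : ℂ | M ≤ ‖z‖} := by simp [le_abs_self]
  refine isPreconnected_of_forall ((|M| : ℝ) : ℂ) fun z hz => ?_
  obtain ⟨w, hw, hwM⟩ := hlog.exists_mem_connectedComponentIn hK hz (M + ‖z‖)
  have hw' : M ≤ ‖w‖ := by linarith [norm_sub_le w z]
  refine ⟨connectedComponentIn Kᶜ z ∪ {z : ℂ | M ≤ ‖z‖},
    union_subset (connectedComponentIn_subset _ _) hMK, .inr hm,
    .inl (mem_connectedComponentIn hz),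
    isPreconnected_connectedComponentIn.union w hw hw' (isPreconnected_le_norm M)⟩

/-- A closed set disjoint from a compact set with connected complement is contained in a closed
connected set that contains a neighbourhood of infinity and is still disjoint from it. -/
theorem exists_isPreconnected_isClosed_superset {K Z : Set ℂ} (hK : IsClosed K)
    (hKc : IsPreconnected Kᶜ) {M : ℝ} (hM : K ⊆ ball 0 M) (hZ : IsClosed Z) (hZK : Z ⊆ Kᶜ) :
    ∃ C, IsClosed C ∧ IsPreconnected C ∧ (∀ z : ℂ, M ≤ ‖z‖ → z ∈ C) ∧ Z ⊆ C ∧ K ⊆ Cᶜ := by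
  set m : ℂ := ((|M| : ℝ) : ℂ) with hm
  have hmM : m ∈ {z : ℂ | M ≤ ‖z‖} := by simp [hm, le_abs_self]
  have hMK : {z : ℂ | M ≤ ‖z‖} ⊆ Kᶜ := fun z hz hzK => by
    have := mem_ball_zero_iff.1 (hM hzK)
    exact this.not_ge hz
  have hKo : IsOpen Kᶜ := hK.isOpen_compl
  have hpath : IsPathConnected Kᶜ := hKo.isConnected_iff_isPathConnected.1 ⟨⟨m, hMK hmM⟩, hKc⟩
  have hB : ∀ z : ℂ, ∃ B : Set ℂ, z ∈ Kᶜ →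
      B ∈ 𝓝 z ∧ IsPreconnected B ∧ IsClosed B ∧ m ∈ B ∧ B ⊆ Kᶜ := by
    intro z
    by_cases hz : z ∈ Kᶜ
    · obtain ⟨ε, hε, hεK⟩ := nhds_basis_closedBall.mem_iff.1 (hKo.mem_nhds hz)
      obtain ⟨Γ, hΓ⟩ := hpath.joinedIn z hz m (hMK hmM)
      refine ⟨closedBall z ε ∪ range Γ, fun _ => ⟨?_, ?_, ?_, ?_, ?_⟩⟩
      · exact mem_of_superset (closedBall_mem_nhds z hε) subset_union_left
      · exact (convex_closedBall z ε).isPreconnected.union z (mem_closedBall_self hε.le)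
          ⟨0, Γ.source⟩ (isPreconnected_range Γ.continuous)
      · exact isClosed_closedBall.union (isCompact_range Γ.continuous).isClosed
      · exact .inr ⟨1, Γ.target⟩
      · exact union_subset hεK (range_subset_iff.2 hΓ)
    · exact ⟨∅, fun h => absurd h hz⟩
  choose B hB using hB
  obtain ⟨t, ht, htc⟩ := ((isCompact_closedBall (0 : ℂ) M).inter_right hZ).elim_nhds_subcover B
    fun z hz => (hB z (hZK hz.2)).1
  refine ⟨{z : ℂ | M ≤ ‖z‖} ∪ ⋃ z ∈ t, B z, ?_, ?_, fun z hz => .inl hz, ?_, ?_⟩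
  · refine (isClosed_le continuous_const continuous_norm).union ?_
    exact t.finite_toSet.isClosed_biUnion fun z hz => (hB z (hZK (ht z hz).2)).2.2.1
  · refine isPreconnected_of_forall m ?_
    rintro y (hy | hy)
    · exact ⟨_, subset_union_left, hmM, hy, isPreconnected_le_norm M⟩
    · obtain ⟨z, hz, hyz⟩ := mem_iUnion₂.1 hy
      obtain ⟨-, h1, -, h2, -⟩ := hB z (hZK (ht z hz).2)
      exact ⟨B z, (subset_biUnion_of_mem (u := fun z => B z) hz).trans subset_union_right, h2,
        hyz, h1⟩
  · intro z hz
    by_cases h : M ≤ ‖z‖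
    · exact .inl h
    · exact .inr (htc ⟨mem_closedBall_zero_iff.2 (not_le.1 h).le, hz⟩)
  · rw [subset_compl_comm]
    refine union_subset hMK (iUnion₂_subset fun z hz => ?_)
    exact (hB z (hZK (ht z hz).2)).2.2.2.2

end

section

open Metric
open scoped unitInterval

/-- The lifting criterion for a local homeomorphism with the path lifting property over `Ω`. -/
theorem IsLocalHomeomorph.exists_lift_of_path_lifting {E X A : Type*} [TopologicalSpace E]
    [TopologicalSpace X] [TopologicalSpace A] {p : E → X} (homeo : IsLocalHomeomorph p)
    (sep : IsSeparatedMap p) [SimplyConnectedSpace A] [LocallyPathConnectedSpace A] {Ω : Set X}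
    (hlift : ∀ (e : E) (Γ : C(I, X)), (∀ t, Γ t ∈ Ω) → Γ 0 = p e →
      ∃ L : C(I, E), L 0 = e ∧ ∀ t, p (L t) = Γ t)
    (f : C(A, X)) (hf : ∀ a, f a ∈ Ω) {a₀ : A} {e₀ : E} (he : p e₀ = f a₀) :
    ∃ F : C(A, E), F a₀ = e₀ ∧ ∀ a, p (F a) = f a := by
  have ex : ∀ γ : C(I, A), γ 0 = a₀ → ∃ Γ : C(I, E), Γ 0 = e₀ ∧ p ∘ Γ = f.comp γ := by
    intro γ hγ
    obtain ⟨L, hL0, hL⟩ := hlift e₀ (f.comp γ) (fun t => hf _) (by simp [hγ, he])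
    exact ⟨L, hL0, funext hL⟩
  obtain ⟨F, ⟨hF0, hF⟩, -⟩ := homeo.existsUnique_continuousMap_lifts f a₀ e₀ he ex (by
    intro γ γ' Γ Γ' h0 h0' hΓ0 hΓ0' hΓ hΓ' h1
    let α : Path a₀ (γ 1) := ⟨γ, h0, rfl⟩
    let α' : Path a₀ (γ 1) := ⟨γ', h0', h1.symm⟩
    obtain ⟨H⟩ := SimplyConnectedSpace.paths_homotopic α α'
    have hslice : ∀ t : I, ∃ Γ : C(I, E), Γ 0 = e₀ ∧ ∀ s, p (Γ s) = f (H (t, s)) := by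
      intro t
      obtain ⟨L, hL0, hL⟩ := ex ⟨fun s => H (t, s), by fun_prop⟩ (by simp)
      exact ⟨L, hL0, fun s => congrFun hL s⟩
    choose K hK0 hK using hslice
    let H' : (f.comp γ).HomotopyRel (f.comp γ') {0, 1} :=
      ContinuousMap.HomotopyRel.compContinuousMap H f
    have hH' : ∀ t s, H' (t, s) = f (H (t, s)) := fun t s => rfl
    have h2 := homeo.monodromy_theorem sep H' K (fun t s => by rw [hK, hH'])
      (fun t => by rw [hK0, hK0]) 1
    have hsec : ∀ (L L' : C(I, E)), L 0 = e₀ → L' 0 = e₀ → (∀ s, p (L s) = p (L' s)) →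
        L 1 = L' 1 := fun L L' hL hL' hp =>
      congrFun (sep.eq_of_comp_eq homeo.isLocallyInjective L.continuous L'.continuous
        (funext hp) 0 (hL.trans hL'.symm)) 1
    have h3 : Γ 1 = K 0 1 := hsec _ _ hΓ0 (hK0 0) fun s => by
      rw [hK, H.apply_zero]
      exact congrFun hΓ s
    have h4 : Γ' 1 = K 1 1 := hsec _ _ hΓ0' (hK0 1) fun s => by
      rw [hK, H.apply_one]
      exact congrFun hΓ' s
    rw [h3, h4, h2])
  exact ⟨F, hF0, fun a => congrFun hF a⟩

end

section

open Metric
open scoped NNReal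

/-- A perturbation of the identity on a set by a map with a small Lipschitz constant extends to a
homeomorphism of the plane. -/
theorem exists_homeomorph_eqOn_of_lipschitz {s : Set ℂ} {φ : ℂ → ℂ}
    (h : ∀ x ∈ s, ∀ y ∈ s, ‖(φ x - x) - (φ y - y)‖ ≤ 1 / 4 * ‖x - y‖) :
    ∃ T : ℂ ≃ₜ ℂ, EqOn T φ s := by
  have hre : LipschitzOnWith (1 / 4 : ℝ≥0) (fun x => (φ x - x).re) s := by
    refine LipschitzOnWith.of_dist_le_mul fun x hx y hy => ?_
    rw [Real.dist_eq, dist_eq_norm, ← Complex.sub_re]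
    exact (Complex.abs_re_le_norm _).trans (by simpa using h x hx y hy)
  have him : LipschitzOnWith (1 / 4 : ℝ≥0) (fun x => (φ x - x).im) s := by
    refine LipschitzOnWith.of_dist_le_mul fun x hx y hy => ?_
    rw [Real.dist_eq, dist_eq_norm, ← Complex.sub_im]
    exact (Complex.abs_im_le_norm _).trans (by simpa using h x hx y hy)
  obtain ⟨u, hu, hus⟩ := hre.extend_real
  obtain ⟨v, hv, hvs⟩ := him.extend_real
  have happ : ApproximatesLinearOn (fun z => z + ⟨u z, v z⟩ : ℂ → ℂ)
      ((ContinuousLinearEquiv.refl ℝ ℂ : ℂ ≃L[ℝ] ℂ) : ℂ →L[ℝ] ℂ) univ (1 / 2) := by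
    intro x _ y _
    have h1 := hu.dist_le_mul x y
    have h2 := hv.dist_le_mul x y
    rw [Real.dist_eq, dist_eq_norm] at h1 h2
    have h3 : (x + ⟨u x, v x⟩ - (y + ⟨u y, v y⟩) -
        ((ContinuousLinearEquiv.refl ℝ ℂ : ℂ ≃L[ℝ] ℂ) : ℂ →L[ℝ] ℂ) (x - y) : ℂ) =
        ⟨u x - u y, v x - v y⟩ := by
      apply Complex.ext <;> (simp; ring)
    rw [h3]
    refine (Complex.norm_le_abs_re_add_abs_im _).trans ?_
    push_cast at h1 h2 ⊢
    linarith
  refine ⟨happ.toHomeomorph _ (.inr ?_), fun z hz => ?_⟩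
  · have h1 : ‖(((ContinuousLinearEquiv.refl ℝ ℂ).symm : ℂ ≃L[ℝ] ℂ) : ℂ →L[ℝ] ℂ)‖₊ = 1 :=
      ContinuousLinearMap.nnnorm_id
    rw [h1, inv_one]
    exact NNReal.half_lt_self one_ne_zero
  · change (z + ⟨u z, v z⟩ : ℂ) = φ z
    rw [← hus hz, ← hvs hz]
    change z + (φ z - z) = φ z
    ring

/-- A univalent function on the unit disc agrees on smaller discs with a homeomorphism of the
plane. -/
theorem exists_homeomorph_eqOn_of_univalent {r : ℂ → ℂ} (hr : DifferentiableOn ℂ r (ball 0 1))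
    (hd : ∀ z ∈ ball (0 : ℂ) 1, deriv r z ≠ 0) (hi : InjOn r (ball 0 1)) {ρ : ℝ} (hρ0 : 0 ≤ ρ)
    (hρ : ρ < 1) : ∃ R : ℂ ≃ₜ ℂ, EqOn R r (closedBall 0 ρ) := by
  set K : Set ℂ := closedBall 0 ρ with hKdef
  have hK : IsCompact K := isCompact_closedBall 0 ρ
  have h0K : (0 : ℂ) ∈ K := mem_closedBall_self hρ0
  have htK : ∀ t ∈ Icc (0 : ℝ) 1, ∀ z ∈ K, (t : ℂ) * z ∈ ball (0 : ℂ) 1 := by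
    intro t ht z hz
    rw [mem_ball_zero_iff, norm_mul, Complex.norm_real, Real.norm_of_nonneg ht.1]
    have h1 : ‖z‖ ≤ ρ := mem_closedBall_zero_iff.1 hz
    nlinarith [ht.2, norm_nonneg z]
  set Δ : ℝ × ℂ × ℂ → ℂ := fun p => dslope r (p.1 * p.2.1) (p.1 * p.2.2) with hΔ
  set Q : Set (ℝ × ℂ × ℂ) := Icc (0 : ℝ) 1 ×ˢ K ×ˢ K with hQ
  have hQc : IsCompact Q := isCompact_Icc.prod (hK.prod hK)
  have hΔc : ContinuousOn Δ Q :=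
    (continuousOn_dslope_uncurry isOpen_ball hr).comp
      (f := fun p : ℝ × ℂ × ℂ => ((p.1 : ℂ) * p.2.1, (p.1 : ℂ) * p.2.2)) (by fun_prop)
      fun p hp => ⟨htK _ hp.1 _ hp.2.1, htK _ hp.1 _ hp.2.2⟩
  have hΔ0 : ∀ p ∈ Q, Δ p ≠ 0 := by
    intro p hp
    have h1 := htK _ hp.1 _ hp.2.1
    have h2 := htK _ hp.1 _ hp.2.2
    rcases eq_or_ne ((p.1 : ℂ) * p.2.2) (p.1 * p.2.1) with h | h
    · simp only [hΔ, h, dslope_same]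
      exact hd _ h1
    · simp only [hΔ, dslope_of_ne _ h, slope_def_field]
      exact div_ne_zero (sub_ne_zero.2 fun e => h (hi h2 h1 e)) (sub_ne_zero.2 h)
  obtain ⟨m, hm0, hm⟩ : ∃ m > 0, ∀ p ∈ Q, m ≤ ‖Δ p‖ := by
    obtain ⟨p, hp, hpm⟩ := hQc.exists_isMinOn ⟨(0, 0, 0), ⟨by simp, h0K, h0K⟩⟩ hΔc.norm
    exact ⟨‖Δ p‖, norm_pos_iff.2 (hΔ0 p hp), fun p' hp' => hpm hp'⟩
  set a : ℝ → ℂ → ℂ := fun t z => z * dslope r 0 (t * z) with ha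
  have hta : ∀ (t : ℝ) z, t * a t z = r (t * z) - r 0 := by
    intro t z
    rw [← sub_smul_dslope r 0 (t * z), smul_eq_mul, sub_zero]
    ring
  have hadiff : ∀ (t : ℝ) z w, a t z - a t w = Δ (t, w, z) * (z - w) := by
    intro t z w
    rcases eq_or_ne t 0 with rfl | ht
    · simp [ha, hΔ]
      ring
    · have ht' : (t : ℂ) ≠ 0 := by exact_mod_cast ht
      apply mul_left_cancel₀ ht'
      rw [mul_sub, hta, hta]
      have := sub_smul_dslope r (t * w) (t * z)
      rw [smul_eq_mul] at this
      simp only [hΔ]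
      linear_combination -this
  obtain ⟨δ, hδ0, hδ⟩ := Metric.uniformContinuousOn_iff.1
    (hQc.uniformContinuousOn_of_continuous hΔc) (m / 4) (by positivity)
  have step : ∀ t ∈ Icc (0 : ℝ) 1, ∀ t' ∈ Icc (0 : ℝ) 1, |t - t'| < δ →
      (∃ R : ℂ ≃ₜ ℂ, EqOn R (a t) K) → ∃ R : ℂ ≃ₜ ℂ, EqOn R (a t') K := by
    rintro t ht t' ht' htt ⟨R, hR⟩
    obtain ⟨T, hT⟩ := exists_homeomorph_eqOn_of_lipschitz (s := R '' K)
      (φ := fun y => a t' (R.symm y)) (by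
        rintro _ ⟨z, hz, rfl⟩ _ ⟨w, hw, rfl⟩
        simp only [Homeomorph.symm_apply_apply]
        rw [hR hz, hR hw]
        have e1 : a t' z - a t z - (a t' w - a t w) =
            (Δ (t', w, z) - Δ (t, w, z)) * (z - w) := by
          linear_combination hadiff t' z w - hadiff t z w
        rw [e1, hadiff t z w, norm_mul, norm_mul]
        have hq : (t, w, z) ∈ Q := ⟨ht, hw, hz⟩
        have hq' : (t', w, z) ∈ Q := ⟨ht', hw, hz⟩
        have h1 : ‖Δ (t', w, z) - Δ (t, w, z)‖ < m / 4 := by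
          rw [← dist_eq_norm]
          refine hδ _ hq' _ hq ?_
          rw [Prod.dist_eq, dist_self, max_eq_left dist_nonneg, Real.dist_eq, abs_sub_comm]
          exact htt
        have h2 := hm _ hq
        rw [← mul_assoc]
        gcongr
        linarith)
    refine ⟨R.trans T, fun z hz => ?_⟩
    have := hT ⟨z, hz, rfl⟩
    simpa using this
  have h0 : ∃ R : ℂ ≃ₜ ℂ, EqOn R (a 0) K := by
    refine ⟨Homeomorph.mulRight₀ (deriv r 0) (hd 0 (by simp)), fun z _ => ?_⟩
    simp [ha]
  obtain ⟨n, hn⟩ := exists_nat_one_div_lt hδ0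
  have hn0 : (0 : ℝ) < n + 1 := by positivity
  have hall : ∀ k : ℕ, k ≤ n + 1 → ∃ R : ℂ ≃ₜ ℂ, EqOn R (a (k / (n + 1))) K := by
    intro k
    induction k with
    | zero => intro _; simpa using h0
    | succ k ih =>
      intro hk
      have hk' : ((k + 1 : ℕ) : ℝ) ≤ n + 1 := by exact_mod_cast hk
      have hk'' : (k : ℝ) + 1 ≤ n + 1 := by exact_mod_cast hk
      refine step (k / (n + 1)) ⟨by positivity, ?_⟩ _ ⟨by positivity, ?_⟩ ?_ (ih (by omega))
      · rw [div_le_one hn0]; linarith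
      · rw [div_le_one hn0]; exact hk'
      · rw [← sub_div, abs_div, abs_of_pos hn0]
        push_cast
        simpa using hn
  obtain ⟨R, hR⟩ := hall (n + 1) le_rfl
  have h1 : (((n + 1 : ℕ) : ℝ) / (n + 1)) = 1 := by
    push_cast
    exact div_self hn0.ne'
  rw [h1] at hR
  refine ⟨R.trans (Homeomorph.addRight (r 0)), fun z hz => ?_⟩
  have h2 := hta 1 z
  simp only [Complex.ofReal_one, one_mul] at h2
  simp [hR hz, h2]

end

section

open Metric
open scoped unitInterval

/-- The plane is homeomorphic to a disc by a homeomorphism that fixes a given smaller disc. -/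
theorem exists_homeomorph_ball_eqOn {ρ ρ' : ℝ} (hρ : 0 < ρ) (hρ' : ρ < ρ') :
    ∃ τ : ℂ ≃ₜ ball (0 : ℂ) ρ', ∀ z ∈ closedBall (0 : ℂ) ρ, (τ z : ℂ) = z := by
  obtain ⟨k, hk, rfl⟩ : ∃ k > 0, ρ' = ρ + k := ⟨ρ' - ρ, sub_pos.2 hρ', by ring⟩
  have hx : ∀ s : ℝ, 0 ≤ max (s - ρ) 0 := fun s => le_max_right _ _
  set lam : ℝ → ℝ := fun s =>
    (ρ + max (s - ρ) 0 * k / (k + max (s - ρ) 0)) / (ρ + max (s - ρ) 0) with hlam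
  set mu : ℝ → ℝ := fun s =>
    (ρ + max (s - ρ) 0 * k / (k - max (s - ρ) 0)) / (ρ + max (s - ρ) 0) with hmu
  have lam_le : ∀ s ≤ ρ, lam s = 1 := fun s hs => by
    simp [hlam, max_eq_right (sub_nonpos.2 hs), hρ.ne']
  have mu_le : ∀ s ≤ ρ, mu s = 1 := fun s hs => by
    simp [hmu, max_eq_right (sub_nonpos.2 hs), hρ.ne']
  have lam_mul : ∀ s, ρ < s → s * lam s = ρ + (s - ρ) * k / (k + (s - ρ)) := fun s hs => by
    have h0 : s ≠ 0 := (hρ.trans hs).ne'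
    simp only [hlam, max_eq_left (sub_pos.2 hs).le, add_sub_cancel]
    field_simp
  have mu_mul : ∀ s, ρ < s → s * mu s = ρ + (s - ρ) * k / (k - (s - ρ)) := fun s hs => by
    have h0 : s ≠ 0 := (hρ.trans hs).ne'
    simp only [hmu, max_eq_left (sub_pos.2 hs).le, add_sub_cancel]
    field_simp
  have lam_pos : ∀ s, 0 < lam s := fun s => by
    have := hx s
    positivity
  have lam_gt : ∀ s, ρ < s → ρ < s * lam s ∧ s * lam s < ρ + k := fun s hs => by
    have h1 : 0 < s - ρ := sub_pos.2 hs
    rw [lam_mul s hs]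
    refine ⟨by linarith [show 0 < (s - ρ) * k / (k + (s - ρ)) by positivity], ?_⟩
    gcongr
    rw [div_lt_iff₀ (by positivity)]
    nlinarith
  have mu_gt : ∀ s, ρ < s → s < ρ + k → ρ < s * mu s ∧ 0 < mu s := fun s hs hs' => by
    have h1 : 0 < s - ρ := sub_pos.2 hs
    have h2 : 0 < k - (s - ρ) := by linarith
    have h3 : ρ < s * mu s := by
      rw [mu_mul s hs]
      linarith [show 0 < (s - ρ) * k / (k - (s - ρ)) by positivity]
    exact ⟨h3, pos_of_mul_pos_right (hρ.trans h3) (hρ.trans hs).le⟩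
  have lam_mu : ∀ s, ρ < s → lam s * mu (s * lam s) = 1 := fun s hs => by
    have h0 : s ≠ 0 := (hρ.trans hs).ne'
    have h1 : 0 < s - ρ := sub_pos.2 hs
    apply mul_left_cancel₀ h0
    rw [← mul_assoc, mu_mul _ (lam_gt s hs).1, lam_mul s hs, add_sub_cancel_left]
    have h2 : k + (s - ρ) ≠ 0 := by positivity
    have h3 : k - (s - ρ) * k / (k + (s - ρ)) = k * k / (k + (s - ρ)) := by
      field_simp
      ring
    rw [h3]
    field_simp
    ring
  have mu_lam : ∀ s, ρ < s → s < ρ + k → mu s * lam (s * mu s) = 1 := fun s hs hs' => by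
    have h0 : s ≠ 0 := (hρ.trans hs).ne'
    have h1 : 0 < s - ρ := sub_pos.2 hs
    have h2 : 0 < k - (s - ρ) := by linarith
    apply mul_left_cancel₀ h0
    rw [← mul_assoc, lam_mul _ (mu_gt s hs hs').1, mu_mul s hs, add_sub_cancel_left]
    have h2' := h2.ne'
    have h3 : k + (s - ρ) * k / (k - (s - ρ)) = k * k / (k - (s - ρ)) := by
      field_simp
      ring
    rw [h3]
    field_simp
    ring
  have nlam : ∀ z : ℂ, ‖z * lam ‖z‖‖ = ‖z‖ * lam ‖z‖ := fun z => by
    rw [norm_mul, Complex.norm_real, Real.norm_of_nonneg (lam_pos _).le]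
  have hτmem : ∀ z : ℂ, z * lam ‖z‖ ∈ ball (0 : ℂ) (ρ + k) := fun z => by
    rw [mem_ball_zero_iff, nlam]
    rcases le_or_gt ‖z‖ ρ with h | h
    · rw [lam_le _ h]; linarith
    · exact (lam_gt _ h).2
  have lamc : Continuous lam := by
    refine Continuous.div (Continuous.add continuous_const (Continuous.div (by fun_prop)
      (by fun_prop) fun s => ?_)) (by fun_prop) fun s => ?_
    · have := hx s; positivity
    · have := hx s; positivity
  have muc : ContinuousOn mu (Iio (ρ + k)) := by
    refine ContinuousOn.div (ContinuousOn.add continuousOn_const (ContinuousOn.div (by fun_prop)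
      (by fun_prop) fun s hs => ?_)) (by fun_prop) fun s hs => ?_
    · have : max (s - ρ) 0 < k := max_lt (by linarith [mem_Iio.1 hs]) hk
      linarith
    · have := hx s; positivity
  refine ⟨{ toFun := fun z => ⟨z * lam ‖z‖, hτmem z⟩
            invFun := fun w => (w : ℂ) * mu ‖(w : ℂ)‖
            left_inv := fun z => ?_
            right_inv := fun w => Subtype.ext ?_
            continuous_toFun := ?_
            continuous_invFun := ?_ }, fun z hz => ?_⟩
  · change z * lam ‖z‖ * mu ‖z * lam ‖z‖‖ = z
    rw [nlam]
    rcases le_or_gt ‖z‖ ρ with h | h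
    · rw [lam_le _ h, mul_one, mu_le _ h]; simp
    · rw [mul_assoc, ← Complex.ofReal_mul, lam_mu _ h]; simp
  · change (w : ℂ) * mu ‖(w : ℂ)‖ * lam ‖(w : ℂ) * mu ‖(w : ℂ)‖‖ = w
    have hw : ‖(w : ℂ)‖ < ρ + k := mem_ball_zero_iff.1 w.2
    rcases le_or_gt ‖(w : ℂ)‖ ρ with h | h
    · rw [mu_le _ h]; simp [lam_le _ h]
    · rw [norm_mul, Complex.norm_real, Real.norm_of_nonneg (mu_gt _ h hw).2.le, mul_assoc,
        ← Complex.ofReal_mul, mu_lam _ h hw]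
      simp
  · refine Continuous.subtype_mk (continuous_id.mul (Complex.continuous_ofReal.comp
      (lamc.comp continuous_norm))) _
  · have h1 : Continuous fun w : ball (0 : ℂ) (ρ + k) => mu ‖(w : ℂ)‖ :=
      muc.comp_continuous (by fun_prop) fun w => mem_ball_zero_iff.1 w.2
    exact continuous_subtype_val.mul (Complex.continuous_ofReal.comp h1)
  · change z * lam ‖z‖ = z
    rw [lam_le _ (mem_closedBall_zero_iff.1 hz)]
    simp

/-- Every open subset of the plane is covered, in the sense of path lifting, by the unit disc
through a local homeomorphism that is holomorphic over a given disc. -/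
theorem exists_covering {Ω : Set ℂ} (hΩ : IsOpen Ω) {z₀ : ℂ} (h0 : z₀ ∈ Ω) {M : ℝ} (hM : 0 < M) :
    ∃ (π : ball (0 : ℂ) 1 → ℂ) (q : ℂ → ℂ), IsLocalHomeomorph π ∧ (∀ e, π e ∈ Ω) ∧
      (∃ e, π e = z₀) ∧
      (∀ (e : ball (0 : ℂ) 1) (Γ : C(I, ℂ)), (∀ t, Γ t ∈ Ω) → Γ 0 = π e →
        ∃ L : C(I, ball (0 : ℂ) 1), L 0 = e ∧ ∀ t, π (L t) = Γ t) ∧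
      DifferentiableOn ℂ q (ball 0 1) ∧ (∀ z ∈ ball (0 : ℂ) 1, deriv q z ≠ 0) ∧
      ∀ e : ball (0 : ℂ) 1, ‖π e‖ ≤ M → q e = π e := by
  obtain ⟨τ, hτ⟩ := exists_homeomorph_ball_eqOn hM (lt_add_one M)
  set Ω' : Set ℂ := Subtype.val '' (τ '' Ω) with hΩ'
  have hΩo : IsOpen Ω' := isOpen_ball.isOpenEmbedding_subtypeVal.isOpenMap _
    (τ.isOpenMap _ hΩ)
  have hmem : ∀ z, z ∈ Ω → (τ z : ℂ) ∈ Ω' := fun z hz => ⟨_, ⟨z, hz, rfl⟩, rfl⟩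
  have hball : ∀ z ∈ Ω', z ∈ ball (0 : ℂ) (M + 1) := by
    rintro _ ⟨w, -, rfl⟩
    exact w.2
  obtain ⟨q, hq, hq', hqΩ, ⟨e₀, he₀, hqe₀⟩, hlift⟩ := exists_holomorphic_covering hΩo
    (B := M + 1) (fun z hz => (mem_ball_zero_iff.1 (hball z hz)).le) (hmem z₀ h0)
  set q' : ball (0 : ℂ) 1 → ball (0 : ℂ) (M + 1) := fun e => ⟨q e, hball _ (hqΩ e e.2)⟩ with hq'def
  have hq'c : Continuous q' := by
    refine Continuous.subtype_mk ?_ _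
    exact hq.continuousOn.comp_continuous continuous_subtype_val fun e => e.2
  have hq'l : IsLocalHomeomorph q' :=
    IsLocalHomeomorph.of_comp (g := Subtype.val) (isLocalHomeomorph_of_deriv_ne_zero hq hq')
      isOpen_ball.isOpenEmbedding_subtypeVal.isLocalHomeomorph hq'c
  refine ⟨fun e => τ.symm (q' e), q, τ.symm.isLocalHomeomorph.comp hq'l, fun e => ?_,
    ⟨⟨e₀, he₀⟩, ?_⟩, fun e Γ hΓ hΓ0 => ?_, hq, hq', fun e he => ?_⟩
  · obtain ⟨w, ⟨z, hz, rfl⟩, hw⟩ := hqΩ e e.2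
    have : q' e = τ z := Subtype.ext hw.symm
    simpa [this] using hz
  · rw [Homeomorph.symm_apply_eq]
    exact Subtype.ext hqe₀
  · obtain ⟨L, hL0, hL⟩ := hlift e ⟨fun t => τ (Γ t), by fun_prop⟩ (fun t => hmem _ (hΓ t)) (by
      change (τ (Γ 0) : ℂ) = q e
      rw [hΓ0, Homeomorph.apply_symm_apply])
    refine ⟨L, hL0, fun t => ?_⟩
    rw [Homeomorph.symm_apply_eq]
    exact Subtype.ext (hL t)
  · have h1 := hτ _ (mem_closedBall_zero_iff.2 he)
    rw [Homeomorph.apply_symm_apply] at h1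
    exact h1

/-- Homeomorphisms lift to homeomorphisms. -/
theorem exists_homeomorph_lift {E X : Type*} [TopologicalSpace E] [T2Space E] [TopologicalSpace X]
    [SimplyConnectedSpace E] [LocallyPathConnectedSpace E] {π : E → X}
    (homeo : IsLocalHomeomorph π) {Ω : Set X} (hπ : ∀ e, π e ∈ Ω)
    (hlift : ∀ (e : E) (Γ : C(I, X)), (∀ t, Γ t ∈ Ω) → Γ 0 = π e →
      ∃ L : C(I, E), L 0 = e ∧ ∀ t, π (L t) = Γ t)
    (G : X ≃ₜ X) (hG : ∀ z, G z ∈ Ω ↔ z ∈ Ω) {e₀ e₁ : E} (he : π e₁ = G (π e₀)) :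
    ∃ G' : E ≃ₜ E, G' e₀ = e₁ ∧ ∀ e, π (G' e) = G (π e) := by
  have sep : IsSeparatedMap π := T2Space.isSeparatedMap π
  have hG' : ∀ z, G.symm z ∈ Ω ↔ z ∈ Ω := fun z => by
    rw [← hG, Homeomorph.apply_symm_apply]
  have hc := homeo.continuous
  obtain ⟨L, hL0, hL⟩ := homeo.exists_lift_of_path_lifting sep hlift
    ⟨fun e => G (π e), by fun_prop⟩ (fun e => (hG _).2 (hπ e)) (a₀ := e₀) (e₀ := e₁) he
  obtain ⟨L', hL0', hL'⟩ := homeo.exists_lift_of_path_lifting sep hlift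
    ⟨fun e => G.symm (π e), by fun_prop⟩ (fun e => (hG' _).2 (hπ e)) (a₀ := e₁) (e₀ := e₀)
    (by simp [he])
  have h1 : L' ∘ L = id := sep.eq_of_comp_eq homeo.isLocallyInjective
    (L'.continuous.comp L.continuous) continuous_id (funext fun e => by simp [hL, hL']) e₀
    (by simp [hL0, hL0'])
  have h2 : L ∘ L' = id := sep.eq_of_comp_eq homeo.isLocallyInjective
    (L.continuous.comp L'.continuous) continuous_id (funext fun e => by simp [hL, hL']) e₁
    (by simp [hL0, hL0'])
  exact ⟨{ toFun := L
           invFun := L'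
           left_inv := congrFun h1
           right_inv := congrFun h2
           continuous_toFun := L.continuous
           continuous_invFun := L'.continuous }, hL0, hL⟩

end

section

open Metric
open scoped unitInterval

/-- A homeomorphism from the disc to the plane that turns a lift of a univalent function into
that function, on a smaller disc. -/
theorem exists_homeomorph_comp_lift_eq {q r : ℂ → ℂ} (S : C(ball (0 : ℂ) 1, ball (0 : ℂ) 1))
    (hq : DifferentiableOn ℂ q (ball 0 1)) (hqd : ∀ z ∈ ball (0 : ℂ) 1, deriv q z ≠ 0)
    (hr : DifferentiableOn ℂ r (ball 0 1)) (hrd : ∀ z ∈ ball (0 : ℂ) 1, deriv r z ≠ 0)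
    (hri : InjOn r (ball 0 1)) (hS : ∀ z, q (S z) = r z) {ρ : ℝ} (hρ0 : 0 ≤ ρ) (hρ : ρ < 1) :
    ∃ Ψ : ball (0 : ℂ) 1 ≃ₜ ℂ, ∀ z : ball (0 : ℂ) 1, ‖(z : ℂ)‖ ≤ ρ → Ψ (S z) = r z := by
  classical
  set S' : ℂ → ℂ := fun z => if h : z ∈ ball (0 : ℂ) 1 then S ⟨z, h⟩ else 0 with hS'def
  have hS' : ∀ z : ball (0 : ℂ) 1, S' z = S z := fun z => dif_pos z.2
  have hmem : ∀ z ∈ ball (0 : ℂ) 1, S' z ∈ ball (0 : ℂ) 1 := fun z hz => by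
    rw [hS' ⟨z, hz⟩]
    exact (S _).2
  have hqS : ∀ z ∈ ball (0 : ℂ) 1, q (S' z) = r z := fun z hz => by
    rw [hS' ⟨z, hz⟩, hS]
  have hc : ContinuousOn S' (ball 0 1) := by
    rw [continuousOn_iff_continuous_domRestrict]
    refine (continuous_subtype_val.comp S.continuous).congr fun z => ?_
    exact (hS' z).symm
  have hev : ∀ z ∈ ball (0 : ℂ) 1, ∀ᶠ w in 𝓝 z, q (S' w) = r w := fun z hz => by
    filter_upwards [isOpen_ball.mem_nhds hz] with w hw using hqS w hw
  have hd : ∀ z ∈ ball (0 : ℂ) 1, DifferentiableAt ℂ S' z := fun z hz =>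
    differentiableAt_of_comp (hc.continuousAt (isOpen_ball.mem_nhds hz))
      (hq.analyticAt (isOpen_ball.mem_nhds (hmem z hz))) (hqd _ (hmem z hz))
      (hr.differentiableAt (isOpen_ball.mem_nhds hz)) (hev z hz)
  have hd0 : ∀ z ∈ ball (0 : ℂ) 1, deriv S' z ≠ 0 := fun z hz h0 => by
    have h1 := ((hq.differentiableAt (isOpen_ball.mem_nhds (hmem z hz))).hasDerivAt.comp z
      (hd z hz).hasDerivAt).deriv
    rw [h0, mul_zero] at h1
    refine hrd z hz ?_
    rw [← h1]
    exact (EventuallyEq.deriv_eq (hev z hz)).symm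
  have hi : InjOn S' (ball 0 1) := fun z hz w hw h =>
    hri hz hw (by rw [← hqS z hz, ← hqS w hw, h])
  obtain ⟨R, hR⟩ := exists_homeomorph_eqOn_of_univalent hr hrd hri hρ0 hρ
  obtain ⟨T, hT⟩ := exists_homeomorph_eqOn_of_univalent
    (fun z hz => (hd z hz).differentiableWithinAt) hd0 hi hρ0 hρ
  have hsub : closedBall (0 : ℂ) ρ ⊆ ball 0 1 := closedBall_subset_ball hρ
  obtain ⟨m, hm, hmax⟩ := (isCompact_closedBall (0 : ℂ) ρ).exists_isMaxOn
    ⟨0, mem_closedBall_self hρ0⟩ (hc.mono hsub).norm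
  have hm1 : ‖S' m‖ < 1 := mem_ball_zero_iff.1 (hmem m (hsub hm))
  obtain ⟨τ, hτ⟩ := exists_homeomorph_ball_eqOn (ρ := (‖S' m‖ + 1) / 2) (ρ' := 1)
    (by positivity) (by linarith)
  refine ⟨τ.symm.trans (T.symm.trans R), fun z hz => ?_⟩
  have hz' := mem_closedBall_zero_iff.2 hz
  have h1 : τ (S' z) = S z := Subtype.ext <| by
    rw [hτ _ (mem_closedBall_zero_iff.2 ?_), hS']
    have : ‖S' z‖ ≤ ‖S' m‖ := hmax hz'
    linarith
  have h2 : τ.symm (S z) = T z := by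
    rw [← h1, Homeomorph.symm_apply_apply, hT hz']
  simp only [Homeomorph.trans_apply, h2, Homeomorph.symm_apply_apply, hR hz']

/-- A homeomorphism of the plane that moves every point of a suitable compact set may be modified
outside of that set so as to have no fixed points at all. -/
theorem exists_fixedPointFree_homeomorph (G : ℂ ≃ₜ ℂ) {D : Set ℂ} (hD : IsCompact D)
    (hDc : IsPreconnected D) (hDlog : HasContinuousLogs D) (hElog : HasContinuousLogs (G '' D))
    (hconn : IsConnected (D ∩ G '' D)) (hfix : ∀ x ∈ D, G x ≠ x) :
    ∃ F : ℂ ≃ₜ ℂ, (∀ x, F x ≠ x) ∧ EqOn F G D ∧ ∃ c, F =ᶠ[𝓝 c] G := by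
  obtain ⟨x₁, hx₁D, hx₁E⟩ := hconn.nonempty
  have hE : IsCompact (G '' D) := hD.image G.continuous
  set K := D ∪ G '' D with hKdef
  have hK : IsCompact K := hD.union hE
  have hKconn : IsPreconnected K :=
    hDc.union x₁ hx₁D hx₁E (hDc.image G G.continuous.continuousOn)
  set Z := {x | G x = x} with hZdef
  have hZ : IsClosed Z := isClosed_eq G.continuous continuous_id
  have hZK : Z ⊆ Kᶜ := by
    rintro x hx (h | ⟨y, hy, rfl⟩)
    · exact hfix x h hx
    · exact hfix y hy (G.injective hx)
  obtain ⟨M, hM0, hM⟩ : ∃ M > 0, K ⊆ ball 0 M := by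
    obtain ⟨M, hM⟩ := hK.isBounded.subset_ball 0
    exact ⟨max M 1, by positivity, hM.trans (ball_subset_ball (le_max_left _ _))⟩
  have hlog := hDlog.union hElog hD.isClosed hE.isClosed hconn
  obtain ⟨C, hC, hCc, hCM, hZC, hKC⟩ := exists_isPreconnected_isClosed_superset hK.isClosed
    (hlog.isPreconnected_compl hK.isClosed hM) hM hZ hZK
  have hx₁K : x₁ ∈ K := Or.inl hx₁D
  obtain ⟨r, hr, hrd, hri, hrN⟩ := exists_riemann_map hC hCc hCM (hKC hx₁K)
  set N := connectedComponentIn Cᶜ x₁ with hN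
  have hKN : K ⊆ N := hKconn.subset_connectedComponentIn hx₁K hKC
  have hNC : N ⊆ Cᶜ := connectedComponentIn_subset _ _
  have hNo : IsOpen N := hC.isOpen_compl.connectedComponentIn
  have hrmem : ∀ z : ball (0 : ℂ) 1, r z ∈ N := fun z => hrN ▸ mem_image_of_mem r z.2
  have hNΩ : ∀ x ∈ N, x ∈ Zᶜ := fun x hx h => hNC hx (hZC h)
  have hNM : ∀ x ∈ N, ‖x‖ ≤ M := fun x hx => by
    by_contra! h
    exact hNC hx (hCM x h.le)
  have : ContractibleSpace (ball (0 : ℂ) 1) :=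
    (convex_ball _ _).contractibleSpace (nonempty_ball.2 one_pos)
  have : LocallyPathConnectedSpace (ball (0 : ℂ) 1) := isOpen_ball.locallyPathConnectedSpace
  obtain ⟨π, q, hπ, hπΩ, ⟨e₀, he₀⟩, hlift, hq, hqd, hqπ⟩ := exists_covering hZ.isOpen_compl
    (hNΩ _ (hrmem ⟨0, mem_ball_self one_pos⟩)) hM0
  have sep : IsSeparatedMap π := T2Space.isSeparatedMap π
  have hrj : Continuous fun z : ball (0 : ℂ) 1 => r z :=
    hr.continuousOn.comp_continuous continuous_subtype_val fun z => z.2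
  obtain ⟨S, -, hS⟩ := hπ.exists_lift_of_path_lifting sep hlift ⟨_, hrj⟩
    (fun z => hNΩ _ (hrmem z)) he₀
  replace hS : ∀ z, π (S z) = r z := hS
  have hj : IsOpenEmbedding fun z : ball (0 : ℂ) 1 => r z :=
    (isLocalHomeomorph_of_deriv_ne_zero hr hrd).isOpenEmbedding_of_injective
      fun z w h => Subtype.ext (hri z.2 w.2 h)
  obtain ⟨s, hs, hrs⟩ : ∃ s : ℂ → ball (0 : ℂ) 1, ContinuousOn s N ∧ ∀ x ∈ N, r (s x) = x := by
    have : Nonempty (ball (0 : ℂ) 1) := ⟨e₀⟩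
    have ht : (hj.toOpenPartialHomeomorph).target = N := by
      rw [← hrN]
      ext x
      simp
    refine ⟨hj.toOpenPartialHomeomorph.symm, ht ▸ hj.toOpenPartialHomeomorph.continuousOn_symm,
      fun x hx => ?_⟩
    exact hj.toOpenPartialHomeomorph.right_inv (ht ▸ hx)
  obtain ⟨m, hm, hmax⟩ := hK.exists_isMaxOn ⟨x₁, hx₁K⟩
    (continuous_subtype_val.comp_continuousOn (hs.mono hKN)).norm
  obtain ⟨ρ, hρm, hρ⟩ : ∃ ρ, ‖(s m : ℂ)‖ < ρ ∧ ρ < 1 :=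
    exists_between (mem_ball_zero_iff.1 (s m).2)
  have hsK : ∀ x ∈ K, ‖(s x : ℂ)‖ < ρ := fun x hx => lt_of_le_of_lt (hmax hx) hρm
  obtain ⟨Ψ, hΨ⟩ := exists_homeomorph_comp_lift_eq S hq hqd hr hrd hri
    (fun z => by rw [hqπ _ (by rw [hS]; exact hNM _ (hrmem z)), hS])
    ((norm_nonneg _).trans hρm.le) hρ
  have hΨs : ∀ x ∈ N, ‖(s x : ℂ)‖ < ρ → Ψ (S (s x)) = x := fun x hx h => by
    rw [hΨ _ h.le, hrs x hx]
  have hGK : ∀ x ∈ D, G x ∈ K := fun x hx => Or.inr ⟨x, hx, rfl⟩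
  have hDK : ∀ x ∈ D, x ∈ K := fun x hx => Or.inl hx
  obtain ⟨G', hG'0, hG'⟩ := exists_homeomorph_lift hπ hπΩ hlift G
    (fun z => by simp [hZdef]) (e₀ := S (s x₁)) (e₁ := S (s (G x₁)))
    (by rw [hS, hS, hrs _ (hKN (hGK _ hx₁D)), hrs _ (hKN hx₁K)])
  obtain ⟨ε, hε, hεN⟩ : ∃ ε > 0, ball x₁ ε ⊆ N ∩ G ⁻¹' N :=
    Metric.isOpen_iff.1 (hNo.inter (hNo.preimage G.continuous)) x₁
      ⟨hKN hx₁K, hKN (hGK _ hx₁D)⟩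
  set W := D ∪ ball x₁ ε with hW
  have hWc : IsPreconnected W :=
    hDc.union x₁ hx₁D (mem_ball_self hε) (convex_ball _ _).isPreconnected
  have hWN : ∀ x ∈ W, x ∈ N ∧ G x ∈ N := by
    rintro x (h | h)
    · exact ⟨hKN (hDK x h), hKN (hGK x h)⟩
    · exact hεN h
  have heq : EqOn (fun x => G' (S (s x))) (fun x => S (s (G x))) W := by
    refine sep.eqOn_of_comp_eqOn hπ.isLocallyInjective hWc ?_ ?_ (fun x hx => ?_)
      (Or.inl hx₁D) hG'0
    · exact (G'.continuous.comp S.continuous).comp_continuousOn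
        (hs.mono fun x hx => (hWN x hx).1)
    · exact S.continuous.comp_continuousOn
        (hs.comp G.continuous.continuousOn fun x hx => (hWN x hx).2)
    · simp only [Function.comp_apply, hG', hS, hrs _ (hWN x hx).1, hrs _ (hWN x hx).2]
  have hFG : ∀ x ∈ W, ‖(s x : ℂ)‖ < ρ → ‖(s (G x) : ℂ)‖ < ρ →
      Ψ.symm.trans (G'.trans Ψ) x = G x := fun x hx h1 h2 => by
    have h3 : Ψ.symm x = S (s x) := by
      rw [Homeomorph.symm_apply_eq, hΨs x (hWN x hx).1 h1]
    simp only [Homeomorph.trans_apply, h3]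
    rw [show G' (S (s x)) = S (s (G x)) from heq hx, hΨs _ (hWN x hx).2 h2]
  refine ⟨Ψ.symm.trans (G'.trans Ψ), fun x hx => ?_, fun x hx => ?_, x₁, ?_⟩
  · have h1 : G' (Ψ.symm x) = Ψ.symm x := by
      rw [← Ψ.injective.eq_iff]
      simpa using hx
    have h2 := hG' (Ψ.symm x)
    rw [h1] at h2
    exact hπΩ _ h2.symm
  · exact hFG x (Or.inl hx) (hsK x (hDK x hx)) (hsK _ (hGK x hx))
  · have hcs : ∀ x ∈ N, ContinuousAt (fun y => ‖(s y : ℂ)‖) x := fun x hx =>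
      (continuous_subtype_val.continuousAt.comp (hs.continuousAt (hNo.mem_nhds hx))).norm
    have h1 := (hcs x₁ (hKN hx₁K)).eventually_lt_const (hsK x₁ hx₁K)
    have h2 := ((hcs (G x₁) (hKN (hGK _ hx₁D))).comp
      G.continuous.continuousAt).eventually_lt_const (hsK _ (hGK _ hx₁D))
    filter_upwards [h1, h2, ball_mem_nhds x₁ hε] with x h1 h2 h3
    exact hFG x (Or.inr h3) h1 h2

end

open Metric in
/-- The Alexander trick: a homeomorphism that is the identity near some point is isotopic to the
identity. -/
theorem exists_alexander_isotopy {V : Type*} [NormedAddCommGroup V] [NormedSpace ℝ V]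
    (k : V ≃ₜ V) {c : V} {ε : ℝ} (hε : 0 < ε) (hk : ∀ x ∈ ball c ε, k x = x) :
    ∃ H : ℝ → V → V, Continuous (fun p : ℝ × V => H p.1 p.2) ∧ (∀ x, H 0 x = x) ∧
      (∀ x, H 1 x = k x) ∧ ∀ t, Function.Bijective (H t) := by
  set H : ℝ → V → V := fun t x => if 0 < t then c + t⁻¹ • (k (c + t • (x - c)) - c) else x with hH
  have hpos : ∀ t x, 0 < t → H t x = c + t⁻¹ • (k (c + t • (x - c)) - c) :=
    fun t x ht => if_pos ht
  have hneg : ∀ t x, ¬ 0 < t → H t x = x := fun t x ht => if_neg ht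
  refine ⟨H, ?_, fun x => hneg 0 x (lt_irrefl 0), fun x => by simp [hpos 1 x one_pos], fun t => ?_⟩
  · refine continuous_iff_continuousAt.2 fun p => ?_
    by_cases hp : 0 < p.1
    · have h1 : ContinuousAt (fun p : ℝ × V => c + p.1⁻¹ • (k (c + p.1 • (p.2 - c)) - c)) p := by
        have hkc := k.continuous
        have h2 : ContinuousAt (fun p : ℝ × V => p.1⁻¹) p := continuousAt_fst.inv₀ hp.ne'
        exact continuousAt_const.add (h2.smul (by fun_prop))
      refine h1.congr ?_
      filter_upwards [continuousAt_fst.eventually_const_lt hp] with q hq using (hpos _ _ hq).symm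
    · have h1 : p.1 * ‖p.2 - c‖ < ε :=
        lt_of_le_of_lt (mul_nonpos_of_nonpos_of_nonneg (not_lt.1 hp) (norm_nonneg _)) hε
      have h2 : ContinuousAt (fun p : ℝ × V => p.1 * ‖p.2 - c‖) p := by fun_prop
      refine continuousAt_snd.congr ?_
      filter_upwards [h2.eventually_lt_const h1] with q hq
      by_cases hq0 : 0 < q.1
      · rw [hpos _ _ hq0, hk, add_sub_cancel_left, inv_smul_smul₀ hq0.ne', add_sub_cancel]
        rwa [mem_ball_iff_norm, add_sub_cancel_left, norm_smul, Real.norm_of_nonneg hq0.le]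
      · exact (hneg _ _ hq0).symm
  · by_cases ht : 0 < t
    · refine Function.bijective_iff_has_inverse.2
        ⟨fun y => c + t⁻¹ • (k.symm (c + t • (y - c)) - c), fun x => ?_, fun y => ?_⟩
      · simp [hpos t x ht, smul_smul, ht.ne']
      · simp [hpos t _ ht, smul_smul, ht.ne']
    · rw [show H t = id from funext fun x => hneg t x ht]
      exact Function.bijective_id

/-- A homeomorphism that agrees with an orientation-preserving one near some point preserves
orientation. -/
theorem IsOrientationPreservingPlaneHomeo.of_eventuallyEq {F G : Plane ≃ₜ Plane}
    (hG : IsOrientationPreservingPlaneHomeo G) {c : Plane} (h : F =ᶠ[𝓝 c] G) :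
    IsOrientationPreservingPlaneHomeo F := by
  obtain ⟨ε, hε, hFG⟩ := Metric.eventually_nhds_iff_ball.1 h
  obtain ⟨k, hk, hk0, hk1, hkb⟩ := exists_alexander_isotopy (F.trans G.symm) (c := c) hε
    fun x hx => by simp [hFG x hx]
  obtain ⟨H, hH, hH0, hH1, hHb⟩ := hG
  refine ⟨fun t x => H t (k t x), hH.comp (continuous_fst.prodMk hk), fun x => ?_, fun x => ?_,
    fun t ht => (hHb t ht).comp (hkb t)⟩
  · simp [hk0, hH0]
  · simp [hk1, hH1]

/-- A fixed-point-free orientation-preserving homeomorphism `f : D → E`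
of a Jordan domain onto its image, with `D ∩ E` non-empty and connected, extends to a
fixed-point-free orientation-preserving homeomorphism of the plane. -/
theorem brouwer_extension (D E : Set Plane) (f : Plane → Plane)
    (hD : IsJordanDomain D)
    (hf : IsHomeoOnto f D E)
    (hor : OrientationPreservingOn f D)
    (hfix : ∀ x ∈ D, f x ≠ x)
    (hconn : IsConnected (D ∩ E)) :
    ∃ F : Plane ≃ₜ Plane, IsOrientationPreservingPlaneHomeo F ∧
      (∀ x : Plane, F x ≠ x) ∧ (∀ x ∈ D, F x = f x) := by
  obtain ⟨e⟩ := hD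
  obtain ⟨G, hG, hfG⟩ := hor
  have hGE : G '' D = E := by rw [← hf.2.2, hfG.image_eq]
  let φ : Plane ≃ₜ ℂ := Complex.orthonormalBasisOneI.repr.symm.toHomeomorph
  have hrange : D = range fun z => (e.symm z : Plane) := by
    rw [range_comp' Subtype.val e.symm, e.symm.surjective.range_eq, image_univ, Subtype.range_coe]
  have hDc : IsCompact D := by
    have : CompactSpace (Metric.closedBall (0 : Plane) 1) :=
      isCompact_iff_compactSpace.1 (isCompact_closedBall _ _)
    rw [hrange]
    exact isCompact_range (by fun_prop)
  have hDp : IsPreconnected D := by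
    have : PreconnectedSpace (Metric.closedBall (0 : Plane) 1) :=
      isPreconnected_iff_preconnectedSpace.1 (convex_closedBall _ _).isPreconnected
    rw [hrange]
    exact isPreconnected_range (by fun_prop)
  set G' : ℂ ≃ₜ ℂ := φ.symm.trans (G.trans φ) with hG'
  have himage : G' '' (φ '' D) = φ '' E := by
    rw [← hGE]
    simp only [image_image, hG', Homeomorph.trans_apply, Homeomorph.symm_apply_apply]
  have e' : (φ '' D) ≃ₜ Metric.closedBall (0 : Plane) 1 := (φ.image D).symm.trans e
  obtain ⟨F, hF, hFD, c, hc⟩ := exists_fixedPointFree_homeomorph G' (D := φ '' D)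
    (hDc.image φ.continuous) (hDp.image _ φ.continuous.continuousOn)
    (hasContinuousLogs_of_homeomorph e')
    (hasContinuousLogs_of_homeomorph ((G'.image _).symm.trans e'))
    (by
      rw [himage, ← image_inter φ.injective]
      exact hconn.image _ φ.continuous.continuousOn)
    (by
      rintro _ ⟨x, hx, rfl⟩ h
      exact hfix x hx (φ.injective (by simpa [hG', hfG hx] using h)))
  refine ⟨φ.trans (F.trans φ.symm), hG.of_eventuallyEq (c := φ.symm c) ?_, fun x hx => ?_,
    fun x hx => ?_⟩
  · have h1 : Tendsto φ (𝓝 (φ.symm c)) (𝓝 c) := by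
      simpa using φ.continuous.tendsto (φ.symm c)
    filter_upwards [h1.eventually hc] with x hx
    simp [hx, hG']
  · exact hF (φ x) (φ.symm.injective (by simpa using hx))
  · simp [hFD (mem_image_of_mem φ hx), hG', hfG hx]
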